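/- arXiv:1809.07919 — 2 statements merged into one kernel-verified Lean document; each statement's English description precedes it below -/
import Mathlib

section
/- Let $B_r(0)$ be the ball of radius $r>0$ centered at the origin in $\mathbb{C}^n$ and let $\alpha\in(0,1)$. Suppose $u\in C^2(B_r(0))\cap C(\overline{B_r(0)})$ is plurisubharmonic on $B_r(0)$ and satisfies $\det(u_{i\bar j})=f$ in $B_r(0)$ and $u=\varphi$ on $\partial B_r(0)$, where $\varphi\in C^{1,\alpha}(\partial B_r(0))$, $f\geq 0$ and $f^{1/n}\in C^{1,\alpha}(\overline{B_r(0)})$. Then for every $t\in(0,1)$ there is a constant $C=C(n,\alpha,t)$ depending only on $n$, $\alpha$ and $t$ such that $[u]_{1,\alpha;B_{(1-t)r}(0)}\leq C\,([\varphi]_{1,\alpha;\partial B_r(0)}+r^{1-\alpha}|f^{1/n}|'_{1,\alpha;B_r(0)})$. -/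
open Metric Set
open scoped ComplexOrder

/-- The complex Hessian matrix `(u_{i j̄})` of a function `u : ℂⁿ → ℝ`, where
`u_{i j̄} = ∂²u/∂z_i∂z̄_j = (1/4)(u_{xᵢxⱼ} + u_{yᵢyⱼ} + i (u_{xᵢyⱼ} - u_{yᵢxⱼ}))`,
computed via real Fréchet derivatives. -/
noncomputable def cxHessian (n : ℕ) (u : EuclideanSpace ℂ (Fin n) → ℝ)
    (z : EuclideanSpace ℂ (Fin n)) : Matrix (Fin n) (Fin n) ℂ :=
  Matrix.of fun i j =>
    (1 / 4 : ℂ) *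
      (Complex.ofReal
          ((fderiv ℝ (fun w => fderiv ℝ u w (EuclideanSpace.single j (1 : ℂ))) z)
              (EuclideanSpace.single i (1 : ℂ))
            + (fderiv ℝ (fun w => fderiv ℝ u w (EuclideanSpace.single j Complex.I)) z)
              (EuclideanSpace.single i Complex.I))
        + Complex.I *
          Complex.ofReal
            ((fderiv ℝ (fun w => fderiv ℝ u w (EuclideanSpace.single j Complex.I)) z)
                (EuclideanSpace.single i (1 : ℂ))
              - (fderiv ℝ (fun w => fderiv ℝ u w (EuclideanSpace.single j (1 : ℂ))) z)
                (EuclideanSpace.single i Complex.I)))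

section MongeAmpere
open Filter Topology

/-- The four-point difference quotient of `F` at `0` converges to `d`. -/
def HasFourPointLimit (F : ℂ → ℝ) (d : ℝ) : Prop :=
  Tendsto (fun s : ℝ => (F s + F (-s) + F (Complex.I * s) + F (-(Complex.I * s)) - 4 * F 0) / s ^ 2)
    (𝓝[>] 0) (𝓝 d)

/-- The Levi form of `u` at `p` in the complex direction `ξ`: `D²u(ξ, ξ) + D²u(iξ, iξ)`. -/
noncomputable def leviForm {E : Type*} [NormedAddCommGroup E] [NormedSpace ℂ E] [NormedSpace ℝ E]
    (u : E → ℝ) (p ξ : E) : ℝ :=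
  fderiv ℝ (fderiv ℝ u) p ξ ξ + fderiv ℝ (fderiv ℝ u) p (Complex.I • ξ) (Complex.I • ξ)

theorem HasFourPointLimit.nonpos_of_isMaxOn {F : ℂ → ℝ} {d : ℝ} (h : HasFourPointLimit F d)
    (hmax : ∀ᶠ z in 𝓝 (0 : ℂ), F z ≤ F 0) : d ≤ 0 := by
  have key : ∀ c : ℂ, ∀ᶠ s : ℝ in 𝓝[>] 0, F (c * s) ≤ F 0 := by
    intro c
    have : Tendsto (fun s : ℝ => c * (s : ℂ)) (𝓝[>] 0) (𝓝 0) := by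
      have : Continuous (fun s : ℝ => c * (s : ℂ)) := by fun_prop
      simpa using (this.tendsto 0).mono_left nhdsWithin_le_nhds
    exact this.eventually hmax
  refine le_of_tendsto h ?_
  filter_upwards [key 1, key (-1), key Complex.I, key (-Complex.I)] with s h1 h2 h3 h4
  simp only [one_mul, neg_mul] at h1 h2 h3 h4
  exact div_nonpos_of_nonpos_of_nonneg (by linarith) (by positivity)

theorem HasFourPointLimit.add {F G : ℂ → ℝ} {c d : ℝ} (hF : HasFourPointLimit F c)
    (hG : HasFourPointLimit G d) : HasFourPointLimit (fun z => F z + G z) (c + d) := by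
  refine (Tendsto.add hF hG).congr fun s => ?_
  ring

theorem HasFourPointLimit.const_mul {F : ℂ → ℝ} {d : ℝ} (hF : HasFourPointLimit F d) (c : ℝ) :
    HasFourPointLimit (fun z => c * F z) (c * d) := by
  refine (Tendsto.const_mul c hF).congr fun s => ?_
  ring

theorem HasFourPointLimit.comp_conj {F : ℂ → ℝ} {d : ℝ} (hF : HasFourPointLimit F d) :
    HasFourPointLimit (fun z => F (starRingEnd ℂ z)) d := by
  refine Tendsto.congr (fun s => ?_) hF
  simp only [map_neg, map_mul, Complex.conj_ofReal, Complex.conj_I, map_zero, neg_mul, neg_neg]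
  ring

theorem hasFourPointLimit_normSq {E : Type*} [NormedAddCommGroup E] [InnerProductSpace ℂ E]
    (p ξ : E) : HasFourPointLimit (fun z => ‖p + z • ξ‖ ^ 2) (4 * ‖ξ‖ ^ 2) := by
  have hpar : ∀ x : E, ‖p + x‖ ^ 2 + ‖p - x‖ ^ 2 = 2 * (‖p‖ ^ 2 + ‖x‖ ^ 2) := by
    intro x
    have := parallelogram_law_with_norm ℂ p x
    nlinarith
  refine tendsto_const_nhds.congr' ?_
  filter_upwards [self_mem_nhdsWithin] with s hs
  have hs : (0 : ℝ) < s := hs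
  have h1 := hpar ((s : ℂ) • ξ)
  have h2 := hpar ((Complex.I * (s : ℂ)) • ξ)
  rw [norm_smul] at h1 h2
  simp only [norm_mul, Complex.norm_I, Complex.norm_real, Real.norm_eq_abs, abs_of_pos hs] at h1 h2
  simp only [neg_smul, ← sub_eq_add_neg, zero_smul, add_zero]
  rw [eq_div_iff (by positivity)]
  linarith

theorem tendsto_secondDifference {φ φ' : ℝ → ℝ} {d : ℝ}
    (h : ∀ᶠ s in 𝓝 0, HasDerivAt φ (φ' s) s) (h' : HasDerivAt φ' d 0) :
    Tendsto (fun s => (φ s + φ (-s) - 2 * φ 0) / s ^ 2) (𝓝[>] 0) (𝓝 d) := by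
  have hneg : ∀ᶠ s in 𝓝 (0 : ℝ), HasDerivAt φ (φ' (-s)) (-s) := by
    have : Tendsto (fun s : ℝ => -s) (𝓝 0) (𝓝 0) := by simpa using (continuous_neg.tendsto (0 : ℝ))
    exact this.eventually h
  have hc : ContinuousAt φ 0 := h.self_of_nhds.continuousAt
  refine HasDerivAt.lhopital_zero_nhdsGT (f' := fun s => φ' s - φ' (-s)) (g' := fun s => 2 * s)
    ?_ ?_ ?_ ?_ ?_ ?_
  · filter_upwards [nhdsWithin_le_nhds h, nhdsWithin_le_nhds hneg] with s h1 h2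
    have h3 : HasDerivAt (fun s => φ (-s)) (φ' (-s) * (-1)) s := h2.comp s (hasDerivAt_neg s)
    exact ((h1.add h3).sub_const (2 * φ 0)).congr_deriv (by ring)
  · filter_upwards with s
    simpa using hasDerivAt_pow 2 s
  · filter_upwards [self_mem_nhdsWithin] with s hs
    have : (0 : ℝ) < s := hs
    positivity
  · have h2 : ContinuousAt (fun s => φ (-s)) 0 := by
      refine ContinuousAt.comp (g := φ) ?_ continuous_neg.continuousAt
      simpa using hc
    have h3 : Tendsto (fun s => φ s + φ (-s) - 2 * φ 0) (𝓝 0) (𝓝 (φ 0 + φ (-0) - 2 * φ 0)) :=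
      (hc.tendsto.add h2.tendsto).sub_const _
    have h4 : φ 0 + φ (-0) - 2 * φ 0 = 0 := by rw [neg_zero]; ring
    rw [h4] at h3
    exact h3.mono_left nhdsWithin_le_nhds
  · have : Continuous (fun s : ℝ => s ^ 2) := by fun_prop
    simpa using (this.tendsto 0).mono_left (nhdsWithin_le_nhds (s := Ioi (0 : ℝ)))
  · have h1 : HasDerivAt (fun s => φ' s - φ' (-s)) (2 * d) 0 := by
      have h3 : HasDerivAt (fun s => φ' (-s)) (d * (-1)) 0 := by
        refine HasDerivAt.comp (h₂ := φ') 0 ?_ (hasDerivAt_neg 0)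
        simpa using h'
      exact (h'.sub h3).congr_deriv (by ring)
    have h2 := (hasDerivAt_iff_tendsto_slope.1 h1).mono_left
      (nhdsWithin_mono 0 (fun x (hx : x ∈ Ioi (0 : ℝ)) => ne_of_gt hx))
    have h3 := h2.const_mul (1 / 2 : ℝ)
    have h4 : (1 / 2 : ℝ) * (2 * d) = d := by ring
    rw [h4] at h3
    refine h3.congr' ?_
    filter_upwards [self_mem_nhdsWithin] with s hs
    have : s ≠ 0 := ne_of_gt hs
    simp only [slope_def_field, neg_zero, sub_self, sub_zero]
    field_simp

section curves
variable {E : Type*} [NormedAddCommGroup E] [NormedSpace ℝ E]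

theorem tendsto_secondDifference_comp_curve {u : E → ℝ} {c c' : ℝ → E} {κ : E}
    (hu : ContDiffAt ℝ 2 u (c 0)) (hc : ∀ᶠ s in 𝓝 0, HasDerivAt c (c' s) s)
    (hc' : HasDerivAt c' κ 0) :
    Tendsto (fun s => (u (c s) + u (c (-s)) - 2 * u (c 0)) / s ^ 2) (𝓝[>] 0)
      (𝓝 (fderiv ℝ (fderiv ℝ u) (c 0) (c' 0) (c' 0) + fderiv ℝ u (c 0) κ)) := by
  have hcc : ContinuousAt c 0 := hc.self_of_nhds.continuousAt
  have hd : ∀ᶠ x in 𝓝 (c 0), DifferentiableAt ℝ u x := by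
    filter_upwards [hu.eventually (by simp)] with x hx
    exact hx.differentiableAt (by norm_num)
  have hd2 : DifferentiableAt ℝ (fderiv ℝ u) (c 0) :=
    (hu.fderiv_right (m := 1) (by norm_num)).differentiableAt (by norm_num)
  refine tendsto_secondDifference (φ := fun s => u (c s)) (φ' := fun s => fderiv ℝ u (c s) (c' s))
    ?_ ?_
  · filter_upwards [hc, hcc.eventually hd] with s h1 h2
    exact h2.hasFDerivAt.comp_hasDerivAt s h1
  · have := (hd2.hasFDerivAt.comp_hasDerivAt 0 hc.self_of_nhds).clm_apply hc'
    exact this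

theorem hasFourPointLimit_comp [NormedSpace ℂ E] [IsScalarTower ℝ ℂ E] [CompleteSpace E] {u : E → ℝ}
    {γ : ℂ → E} (hu : ContDiffAt ℝ 2 u (γ 0)) (hγ : ∀ᶠ z in 𝓝 0, DifferentiableAt ℂ γ z) :
    HasFourPointLimit (fun z => u (γ z)) (leviForm u (γ 0) (deriv γ 0)) := by
  have hγ' : DifferentiableAt ℂ (deriv γ) 0 := by
    obtain ⟨U, hU, hUo, h0⟩ := _root_.eventually_nhds_iff.1 hγ
    have : DifferentiableOn ℂ γ U := fun z hz => (hU z hz).differentiableWithinAt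
    exact (this.deriv hUo).differentiableAt (hUo.mem_nhds h0)
  have line : ∀ c : ℂ, Tendsto (fun s : ℝ => (u (γ (c * s)) + u (γ (c * (-s : ℝ))) - 2 * u (γ 0)) / s ^ 2)
      (𝓝[>] 0) (𝓝 (fderiv ℝ (fderiv ℝ u) (γ 0) (c • deriv γ 0) (c • deriv γ 0)
        + fderiv ℝ u (γ 0) ((c * c) • deriv (deriv γ) 0))) := by
    intro c
    have hl : ∀ s : ℝ, HasDerivAt (fun s : ℝ => c * (s : ℂ)) c s := by
      intro s
      simpa using (Complex.ofRealCLM.hasDerivAt (x := s)).const_mul c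
    have hcont : Tendsto (fun s : ℝ => c * (s : ℂ)) (𝓝 0) (𝓝 0) := by
      have : Continuous (fun s : ℝ => c * (s : ℂ)) := by fun_prop
      simpa using this.tendsto 0
    have := tendsto_secondDifference_comp_curve (u := u) (c := fun s : ℝ => γ (c * s))
      (c' := fun s : ℝ => c • deriv γ (c * s)) (κ := (c * c) • deriv (deriv γ) 0) (by simpa using hu)
      ?_ ?_
    · simpa using this
    · filter_upwards [hcont.eventually hγ] with s hs
      exact hs.hasDerivAt.scomp s (hl s)
    · have h1 : HasDerivAt (deriv γ) (deriv (deriv γ) 0) (c * ((0 : ℝ) : ℂ)) := by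
        simpa using hγ'.hasDerivAt
      have := (h1.scomp (0 : ℝ) (hl 0)).const_smul c
      rw [smul_smul] at this
      exact this
  have h := (line 1).add (line Complex.I)
  unfold HasFourPointLimit leviForm
  convert h using 2 with s
  · rw [← add_div]
    congr 1
    simp only [one_mul, Complex.ofReal_neg, mul_neg]
    ring
  · simp
    ring
end curves

open scoped Matrix MatrixOrder in
theorem Matrix.PosDef.exists_conjTranspose_mul_mul_eq_one {ι : Type*} [Fintype ι] [DecidableEq ι]
    {A : Matrix ι ι ℂ} (hA : A.PosDef) : ∃ S : Matrix ι ι ℂ, Sᴴ * A * S = 1 := by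
  obtain ⟨B, hB, rfl⟩ := CStarAlgebra.isStrictlyPositive_iff_eq_star_mul_self.mp
    hA.isStrictlyPositive
  obtain ⟨S, hS⟩ := hB.exists_right_inv
  refine ⟨S, ?_⟩
  calc Sᴴ * (star B * B) * S = (B * S)ᴴ * (B * S) := by
        rw [Matrix.conjTranspose_mul, Matrix.star_eq_conjTranspose]; simp only [mul_assoc]
    _ = 1 := by rw [hS]; simp

theorem Matrix.PosSemidef.card_mul_le_re_trace {ι : Type*} [Fintype ι] [DecidableEq ι] [Nonempty ι]
    {A : Matrix ι ι ℂ} (hA : A.PosSemidef) {m : ℝ} (hm : 0 ≤ m)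
    (hdet : A.det = ((m ^ Fintype.card ι : ℝ) : ℂ)) : Fintype.card ι * m ≤ A.trace.re := by
  have hdet' : ∏ i, hA.1.eigenvalues i = m ^ Fintype.card ι := by
    have h := hA.1.det_eq_prod_eigenvalues
    rw [hdet] at h
    have h2 : ((m ^ Fintype.card ι : ℝ) : ℂ) = ((∏ i, hA.1.eigenvalues i : ℝ) : ℂ) := by
      rw [h]; push_cast; rfl
    exact (Complex.ofReal_injective h2).symm
  have htr : A.trace.re = ∑ i, hA.1.eigenvalues i := by
    rw [hA.1.trace_eq_sum_eigenvalues]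
    simp
  have h := Real.geom_mean_le_arith_mean Finset.univ (fun _ => (1 : ℝ)) hA.1.eigenvalues
    (fun _ _ => zero_le_one) (by simp [Fintype.card_pos]) (fun i _ => hA.eigenvalues_nonneg i)
  simp only [Real.rpow_one, one_mul, Finset.sum_const, Finset.card_univ, nsmul_eq_mul, mul_one] at h
  rw [hdet', ← htr, Real.pow_rpow_inv_natCast hm Fintype.card_ne_zero,
    le_div_iff₀ (by exact_mod_cast Fintype.card_pos)] at h
  linarith

open scoped Matrix in
theorem add_le_of_quadraticForm_le {ι : Type*} [Fintype ι] [DecidableEq ι] [Nonempty ι]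
    {A M N : Matrix ι ι ℂ} (hA : A.PosSemidef) (hM : M.PosSemidef) (hN : N.PosSemidef)
    {a m k c : ℝ} (ha : 0 ≤ a) (hm : 0 ≤ m) (hk : 0 ≤ k) (hc : 0 < c)
    (hAdet : A.det = ((a ^ Fintype.card ι : ℝ) : ℂ)) (hMdet : M.det = ((m ^ Fintype.card ι : ℝ) : ℂ))
    (hNdet : N.det = ((k ^ Fintype.card ι : ℝ) : ℂ))
    (h : ∀ ξ : ι → ℂ, (star ξ ⬝ᵥ M *ᵥ ξ).re + (star ξ ⬝ᵥ N *ᵥ ξ).re + c * (star ξ ⬝ᵥ ξ).re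
      ≤ (star ξ ⬝ᵥ A *ᵥ ξ).re) :
    m + k + c ≤ a := by
  have hApos : A.PosDef := by
    refine Matrix.PosDef.of_dotProduct_mulVec_pos hA.1 fun x hx => ?_
    have h1 : 0 < (star x ⬝ᵥ x) := Matrix.dotProduct_star_self_pos_iff.2 hx
    have h2 : 0 ≤ star x ⬝ᵥ A *ᵥ x := hA.dotProduct_mulVec_nonneg x
    have h3 := hM.re_dotProduct_nonneg x
    have h4 := hN.re_dotProduct_nonneg x
    rw [Complex.lt_def] at h1 ⊢
    rw [Complex.le_def] at h2
    refine ⟨?_, h2.2⟩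
    have := mul_pos hc h1.1
    have := h x
    simp only [Complex.zero_re, RCLike.re_to_complex] at *
    linarith
  obtain ⟨S, hS⟩ := hApos.exists_conjTranspose_mul_mul_eq_one
  have hapos : 0 < a := by
    have := hApos.det_pos
    rw [hAdet] at this
    have h2 : 0 < a ^ Fintype.card ι := by exact_mod_cast this
    exact lt_of_le_of_ne ha (fun h0 => by simp [← h0, Fintype.card_ne_zero] at h2)
  have hdetS : star S.det * S.det * ((a ^ Fintype.card ι : ℝ) : ℂ) = 1 := by
    have := congrArg Matrix.det hS
    rw [Matrix.det_mul, Matrix.det_mul, Matrix.det_conjTranspose, hAdet, Matrix.det_one] at this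
    linear_combination this
  have hdiag : ∀ (X : Matrix ι ι ℂ) (i : ι),
      (Sᴴ * X * S) i i = star (S.col i) ⬝ᵥ X *ᵥ (S.col i) := by
    intro X i
    rw [Matrix.mul_assoc, Matrix.mul_apply]
    rfl
  have hdet : ∀ (X : Matrix ι ι ℂ) (x : ℝ), X.det = ((x ^ Fintype.card ι : ℝ) : ℂ) →
      (Sᴴ * X * S).det = (((x / a) ^ Fintype.card ι : ℝ) : ℂ) := by
    intro X x hX
    rw [Matrix.det_mul, Matrix.det_mul, Matrix.det_conjTranspose, hX, div_pow, Complex.ofReal_div,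
      eq_div_iff (by exact_mod_cast (pow_pos hapos _).ne')]
    linear_combination ((x ^ Fintype.card ι : ℝ) : ℂ) * hdetS
  have tM := (hM.conjTranspose_mul_mul_same S).card_mul_le_re_trace (div_nonneg hm hapos.le)
    (hdet M m hMdet)
  have tN := (hN.conjTranspose_mul_mul_same S).card_mul_le_re_trace (div_nonneg hk hapos.le)
    (hdet N k hNdet)
  have tI := (Matrix.PosSemidef.one.conjTranspose_mul_mul_same S).card_mul_le_re_trace
    (div_nonneg zero_le_one hapos.le) (hdet 1 1 (by simp))
  have hsum : (Sᴴ * M * S).trace.re + (Sᴴ * N * S).trace.re + c * (Sᴴ * 1 * S).trace.re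
      ≤ Fintype.card ι := by
    have : (Fintype.card ι : ℝ) = (Sᴴ * A * S).trace.re := by rw [hS]; simp
    rw [this]
    simp only [Matrix.trace, Matrix.diag, Complex.re_sum, Finset.mul_sum,
      ← Finset.sum_add_distrib]
    refine Finset.sum_le_sum fun i _ => ?_
    rw [hdiag, hdiag, hdiag, hdiag, Matrix.one_mulVec]
    exact h _
  have hn : (0 : ℝ) < Fintype.card ι := by exact_mod_cast Fintype.card_pos
  have h5 := mul_le_mul_of_nonneg_left tI hc.le
  have h6 : (Fintype.card ι : ℝ) * ((m + k + c) / a) ≤ Fintype.card ι * 1 := by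
    calc (Fintype.card ι : ℝ) * ((m + k + c) / a) = Fintype.card ι * (m / a) + Fintype.card ι * (k / a)
          + c * (Fintype.card ι * (1 / a)) := by ring
      _ ≤ Fintype.card ι * 1 := by linarith
  have h7 := le_of_mul_le_mul_left h6 hn
  rwa [div_le_one hapos] at h7

/-- The sesquilinear form attached to a real bilinear form `D`, equal to the complex Hessian
when `D` is the second derivative of a function. -/
noncomputable def sesq {E : Type*} [NormedAddCommGroup E] [NormedSpace ℂ E] [NormedSpace ℝ E]
    (D : E →L[ℝ] E →L[ℝ] ℝ) (x y : E) : ℂ :=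
  (1 / 4 : ℂ) * (Complex.ofReal (D x y + D (Complex.I • x) (Complex.I • y))
    + Complex.I * Complex.ofReal (D x (Complex.I • y) - D (Complex.I • x) y))

section
variable {E : Type*} [NormedAddCommGroup E] [NormedSpace ℂ E] [NormedSpace ℝ E]
    (D : E →L[ℝ] E →L[ℝ] ℝ)

theorem complex_smul_eq [IsScalarTower ℝ ℂ E] (c : ℂ) (x : E) :
    c • x = c.re • x + c.im • (Complex.I • x) := by
  conv_lhs => rw [← Complex.re_add_im c]
  rw [add_smul, mul_smul, ← Complex.coe_algebraMap, algebraMap_smul, algebraMap_smul]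

theorem sesq_smul_left [IsScalarTower ℝ ℂ E] (c : ℂ) (x y : E) :
    sesq D (c • x) y = c * sesq D x y := by
  have h : Complex.I • c • x = c.re • (Complex.I • x) - c.im • x := by
    rw [smul_smul, mul_comm, ← smul_smul, complex_smul_eq c (Complex.I • x), smul_smul Complex.I,
      Complex.I_mul_I, neg_one_smul, smul_neg, sub_eq_add_neg]
  unfold sesq
  rw [h, complex_smul_eq c x]
  apply Complex.ext <;> simp <;> ring

theorem sesq_smul_right [IsScalarTower ℝ ℂ E] (c : ℂ) (x y : E) :
    sesq D x (c • y) = starRingEnd ℂ c * sesq D x y := by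
  have h : Complex.I • c • y = c.re • (Complex.I • y) - c.im • y := by
    rw [smul_smul, mul_comm, ← smul_smul, complex_smul_eq c (Complex.I • y), smul_smul Complex.I,
      Complex.I_mul_I, neg_one_smul, smul_neg, sub_eq_add_neg]
  unfold sesq
  rw [h, complex_smul_eq c y]
  apply Complex.ext <;> simp <;> ring

theorem sesq_sum_left {ι : Type*} (s : Finset ι) (x : ι → E) (y : E) :
    sesq D (∑ i ∈ s, x i) y = ∑ i ∈ s, sesq D (x i) y := by
  simp only [sesq, Finset.smul_sum, map_sum, FunLike.coe_sum, Finset.sum_apply,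
    ← Finset.sum_add_distrib, ← Finset.sum_sub_distrib, Complex.ofReal_sum]
  simp only [Finset.mul_sum, ← Finset.sum_add_distrib]

theorem sesq_sum_right {ι : Type*} (s : Finset ι) (x : E) (y : ι → E) :
    sesq D x (∑ i ∈ s, y i) = ∑ i ∈ s, sesq D x (y i) := by
  simp only [sesq, Finset.smul_sum, map_sum,
    ← Finset.sum_add_distrib, ← Finset.sum_sub_distrib, Complex.ofReal_sum]
  simp only [Finset.mul_sum, ← Finset.sum_add_distrib]
end

open scoped Matrix in
theorem cxHessian_quadraticForm {n : ℕ} {u : EuclideanSpace ℂ (Fin n) → ℝ}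
    {p : EuclideanSpace ℂ (Fin n)} (hu : ContDiffAt ℝ 2 u p) (ξ : EuclideanSpace ℂ (Fin n)) :
    4 * (star (ξ : Fin n → ℂ) ⬝ᵥ (cxHessian n u p)ᵀ *ᵥ (ξ : Fin n → ℂ)).re = leviForm u p ξ := by
  set D := fderiv ℝ (fderiv ℝ u) p with hD
  have hd : DifferentiableAt ℝ (fderiv ℝ u) p :=
    (hu.fderiv_right (m := 1) (by norm_num)).differentiableAt (by norm_num)
  have hdd : ∀ x y : EuclideanSpace ℂ (Fin n), fderiv ℝ (fun w => fderiv ℝ u w y) p x = D x y := by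
    intro x y
    rw [fderiv_clm_apply hd (differentiableAt_const y)]
    simp [hD]
  have hI : ∀ i : Fin n, (EuclideanSpace.single i Complex.I : EuclideanSpace ℂ (Fin n))
      = Complex.I • EuclideanSpace.single i (1 : ℂ) := by
    intro i
    ext j
    simp
  have hent : ∀ i j, cxHessian n u p i j
      = sesq D (EuclideanSpace.single i (1 : ℂ)) (EuclideanSpace.single j (1 : ℂ)) := by
    intro i j
    simp only [cxHessian, Matrix.of_apply, hdd, hI, sesq]
  have hξ : ξ = ∑ i, ξ i • (EuclideanSpace.single i (1 : ℂ) : EuclideanSpace ℂ (Fin n)) := by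
    ext j
    simp [Pi.single_apply]
  have hs : star (ξ : Fin n → ℂ) ⬝ᵥ (cxHessian n u p)ᵀ *ᵥ (ξ : Fin n → ℂ) = sesq D ξ ξ := by
    conv_rhs => rw [hξ]
    rw [sesq_sum_left]
    simp only [sesq_sum_right, sesq_smul_left, sesq_smul_right, dotProduct, Matrix.mulVec,
      Matrix.transpose_apply, hent, Pi.star_apply, Finset.mul_sum]
    rw [Finset.sum_comm]
    refine Finset.sum_congr rfl fun i _ => Finset.sum_congr rfl fun j _ => ?_
    simp only [RCLike.star_def]
    ring
  rw [hs]
  simp [sesq, leviForm, hD]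

section automorphism
variable {E : Type*} [NormedAddCommGroup E] [InnerProductSpace ℂ E]

/-- The numerator of the ball automorphism. -/
noncomputable def ballAutNum (b z : E) : E :=
  b + ((Real.sqrt (1 - ‖b‖ ^ 2) : ℝ) : ℂ) • z
    + (inner ℂ b z / ((1 + Real.sqrt (1 - ‖b‖ ^ 2) : ℝ) : ℂ)) • b

/-- The holomorphic automorphism of the unit ball which sends `0` to `b`. -/
noncomputable def ballAut (b z : E) : E := (1 + inner ℂ b z)⁻¹ • ballAutNum b z

@[simp]
theorem ballAut_zero (b : E) : ballAut b 0 = b := by simp [ballAut, ballAutNum]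

theorem one_add_inner_ne_zero {b z : E} (hb : ‖b‖ < 1) (hz : ‖z‖ ≤ 1) :
    (1 + inner ℂ b z : ℂ) ≠ 0 := by
  intro h
  have h1 : (inner ℂ b z : ℂ) = -1 := by linear_combination h
  have h2 := norm_inner_le_norm (𝕜 := ℂ) b z
  rw [h1, norm_neg, norm_one] at h2
  nlinarith [norm_nonneg b, norm_nonneg z]

theorem normSq_ballAutNum {b : E} (hb : ‖b‖ ≤ 1) (z : E) :
    ‖ballAutNum b z‖ ^ 2 = ‖(1 + inner ℂ b z : ℂ)‖ ^ 2 - (1 - ‖b‖ ^ 2) * (1 - ‖z‖ ^ 2) := by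
  set s := Real.sqrt (1 - ‖b‖ ^ 2) with hs
  have hs0 : 0 ≤ s := Real.sqrt_nonneg _
  have hs2 : s ^ 2 = 1 - ‖b‖ ^ 2 := Real.sq_sqrt (by nlinarith [norm_nonneg b])
  have hb2 : ‖b‖ ^ 2 = 1 - s ^ 2 := by linarith
  set β : ℂ := inner ℂ b z with hβ
  have hs1 : (1 + s) ≠ 0 := by positivity
  obtain ⟨q, hq⟩ : ∃ q : ℝ, q = (1 + s)⁻¹ := ⟨_, rfl⟩
  have hqs : q * (1 + s) = 1 := by rw [hq]; field_simp
  have e1 : ballAutNum b z = (1 + (q : ℂ) * β) • b + (s : ℂ) • z := by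
    simp only [ballAutNum, add_smul, one_smul, ← hs, ← hβ, div_eq_inv_mul, hq, Complex.ofReal_inv]
    abel
  rw [e1, @norm_add_sq ℂ, inner_smul_left, inner_smul_right, norm_smul, norm_smul, ← hβ]
  simp only [mul_pow]
  rw [hb2, ← Complex.normSq_eq_norm_sq, ← Complex.normSq_eq_norm_sq, ← Complex.normSq_eq_norm_sq]
  simp only [Complex.normSq_apply, RCLike.re_to_complex]
  simp
  linear_combination (2 * β.re * (1 - s) + (β.re ^ 2 + β.im ^ 2) * (q * (1 - s) + 1)) * hqs

theorem one_sub_normSq_ballAut {b z : E} (hb : ‖b‖ < 1) (hz : ‖z‖ ≤ 1) :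
    1 - ‖ballAut b z‖ ^ 2 = (1 - ‖b‖ ^ 2) * (1 - ‖z‖ ^ 2) / ‖(1 + inner ℂ b z : ℂ)‖ ^ 2 := by
  have h0 : ‖(1 + inner ℂ b z : ℂ)‖ ≠ 0 := norm_ne_zero_iff.2 (one_add_inner_ne_zero hb hz)
  rw [ballAut, norm_smul, mul_pow, normSq_ballAutNum hb.le, norm_inv]
  field_simp
  ring

theorem norm_ballAut_lt_one {b z : E} (hb : ‖b‖ < 1) (hz : ‖z‖ < 1) : ‖ballAut b z‖ < 1 := by
  have h0 : 0 < ‖(1 + inner ℂ b z : ℂ)‖ := norm_pos_iff.2 (one_add_inner_ne_zero hb hz.le)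
  have h1 : 0 < 1 - ‖b‖ ^ 2 := by nlinarith [norm_nonneg b]
  have h2 : 0 < 1 - ‖z‖ ^ 2 := by nlinarith [norm_nonneg z]
  have h3 : 0 < 1 - ‖ballAut b z‖ ^ 2 := by
    rw [one_sub_normSq_ballAut hb hz.le]; positivity
  nlinarith [norm_nonneg (ballAut b z)]

theorem norm_ballAut_eq_one {b z : E} (hb : ‖b‖ < 1) (hz : ‖z‖ = 1) : ‖ballAut b z‖ = 1 := by
  have h3 := one_sub_normSq_ballAut hb hz.le
  rw [hz] at h3
  simp only [one_pow, sub_self, mul_zero, zero_div] at h3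
  have : ‖ballAut b z‖ ^ 2 = 1 := by linarith
  exact (pow_eq_one_iff_of_nonneg (norm_nonneg _) two_ne_zero).1 this

theorem norm_ballAut_le_one {b z : E} (hb : ‖b‖ < 1) (hz : ‖z‖ ≤ 1) : ‖ballAut b z‖ ≤ 1 :=
  hz.lt_or_eq.elim (fun h => (norm_ballAut_lt_one hb h).le) fun h => (norm_ballAut_eq_one hb h).le

/-- The direction of the rank one part of the complex derivative of `ballAut b` at `z`. -/
noncomputable def ballAutDir (b z : E) : E :=
  (1 + inner ℂ b z : ℂ)⁻¹ • (((1 + Real.sqrt (1 - ‖b‖ ^ 2) : ℝ) : ℂ)⁻¹ • b - ballAut b z)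

/-- The scalar part of the complex derivative of `ballAut b` at `z`. -/
noncomputable def ballAutScale (b z : E) : ℂ :=
  ((Real.sqrt (1 - ‖b‖ ^ 2) : ℝ) : ℂ) / (1 + inner ℂ b z)

theorem hasDerivAt_ballAut_line {b z : E} (hb : ‖b‖ < 1) (hz : ‖z‖ ≤ 1) (ξ : E) :
    HasDerivAt (fun ζ : ℂ => ballAut b (z + ζ • ξ))
      (ballAutScale b z • ξ + inner ℂ b ξ • ballAutDir b z) 0 := by
  have hl : HasDerivAt (fun ζ : ℂ => z + ζ • ξ) ξ 0 := by
    simpa using ((hasDerivAt_id (0 : ℂ)).smul_const ξ).const_add z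
  have hi : HasDerivAt (fun ζ : ℂ => (inner ℂ b (z + ζ • ξ) : ℂ)) (inner ℂ b ξ) 0 :=
    (innerSL ℂ b).hasFDerivAt.comp_hasDerivAt (0 : ℂ) hl
  have hne : (1 + inner ℂ b (z + (0 : ℂ) • ξ) : ℂ) ≠ 0 := by
    simpa using one_add_inner_ne_zero hb hz
  have hN : HasDerivAt (fun ζ : ℂ => ballAutNum b (z + ζ • ξ))
      (((Real.sqrt (1 - ‖b‖ ^ 2) : ℝ) : ℂ) • ξ
        + (inner ℂ b ξ / ((1 + Real.sqrt (1 - ‖b‖ ^ 2) : ℝ) : ℂ)) • b) 0 :=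
    ((hl.const_smul _).const_add b).add ((hi.div_const _).smul_const b)
  have := ((hi.const_add 1).inv hne).smul hN
  refine this.congr_deriv ?_
  simp only [zero_smul, add_zero, ballAutScale, ballAutDir, ballAut] at hne ⊢
  simp only [Pi.inv_apply, zero_smul, add_zero]
  generalize (1 + inner ℂ b z : ℂ) = d
  module

theorem contDiffAt_ballAut [NormedSpace ℝ E] [IsScalarTower ℝ ℂ E] {b z : E}
    (hb : ‖b‖ < 1) (hz : ‖z‖ ≤ 1) :
    ContDiffAt ℝ 2 (fun x : E × E => ballAut x.1 x.2) (b, z) := by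
  have hs : ContDiffAt ℝ 2 (fun x : E × E => Real.sqrt (1 - ‖x.1‖ ^ 2)) (b, z) := by
    refine ContDiffAt.sqrt ?_ ?_
    · exact contDiffAt_const.sub (contDiffAt_fst.norm_sq ℂ)
    · have : ‖b‖ ^ 2 < 1 := by nlinarith [norm_nonneg b]
      simp only
      linarith
  have hi : ContDiffAt ℝ 2 (fun x : E × E => (inner ℂ x.1 x.2 : ℂ)) (b, z) :=
    contDiffAt_fst.inner ℂ contDiffAt_snd
  have hsc : ContDiffAt ℝ 2 (fun x : E × E => ((Real.sqrt (1 - ‖x.1‖ ^ 2) : ℝ) : ℂ)) (b, z) :=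
    Complex.ofRealCLM.contDiff.contDiffAt.comp (b, z) hs
  have hsc1 : ContDiffAt ℝ 2 (fun x : E × E => ((1 + Real.sqrt (1 - ‖x.1‖ ^ 2) : ℝ) : ℂ)) (b, z) :=
    Complex.ofRealCLM.contDiff.contDiffAt.comp (b, z) (contDiffAt_const.add hs)
  refine ContDiffAt.smul ((contDiffAt_const.add hi).inv (one_add_inner_ne_zero hb hz)) ?_
  simp only [ballAutNum, div_eq_mul_inv]
  refine (contDiffAt_fst.add (hsc.smul contDiffAt_snd)).add
    ((hi.mul (hsc1.inv ?_)).smul contDiffAt_fst)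
  have : (1 + Real.sqrt (1 - ‖b‖ ^ 2)) ≠ 0 := by positivity
  exact_mod_cast this

/-- The `(1 / n)`-th power of the real Jacobian determinant of the automorphism `ballAut b`. -/
noncomputable def ballAutWeight (n : ℕ) (b z : E) : ℝ :=
  ((1 - ‖b‖ ^ 2) / ‖(1 + inner ℂ b z : ℂ)‖ ^ 2) ^ (((n : ℝ) + 1) / n)

theorem ballAutWeight_nonneg (n : ℕ) {b : E} (hb : ‖b‖ < 1) (z : E) : 0 ≤ ballAutWeight n b z := by
  have h1 : 0 < 1 - ‖b‖ ^ 2 := by nlinarith [norm_nonneg b]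
  unfold ballAutWeight
  positivity

theorem contDiffAt_ballAutWeight [NormedSpace ℝ E] [IsScalarTower ℝ ℂ E] (n : ℕ) {b z : E}
    (hb : ‖b‖ < 1) (hz : ‖z‖ ≤ 1) :
    ContDiffAt ℝ 2 (fun x : E × E => ballAutWeight n x.1 x.2) (b, z) := by
  have hi : ContDiffAt ℝ 2 (fun x : E × E => (inner ℂ x.1 x.2 : ℂ)) (b, z) :=
    contDiffAt_fst.inner ℂ contDiffAt_snd
  have h0 : 0 < ‖(1 + inner ℂ b z : ℂ)‖ := norm_pos_iff.2 (one_add_inner_ne_zero hb hz)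
  have h1 : 0 < 1 - ‖b‖ ^ 2 := by nlinarith [norm_nonneg b]
  refine ContDiffAt.rpow_const_of_ne (ContDiffAt.div (contDiffAt_const.sub (contDiffAt_fst.norm_sq ℂ))
    ((contDiffAt_const.add hi).norm_sq ℂ) (by positivity)) ?_
  have : 0 < (1 - ‖b‖ ^ 2) / ‖(1 + inner ℂ b z : ℂ)‖ ^ 2 := by positivity
  exact this.ne'

theorem inner_ballAutDir {b z : E} (hb : ‖b‖ < 1) (hz : ‖z‖ ≤ 1) :
    (1 + inner ℂ b z) * inner ℂ b (ballAutDir b z)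
      = ((Real.sqrt (1 - ‖b‖ ^ 2) : ℝ) : ℂ) * (ballAutScale b z - 1) := by
  have hd := one_add_inner_ne_zero hb hz
  unfold ballAutDir ballAutScale ballAut ballAutNum
  set s := Real.sqrt (1 - ‖b‖ ^ 2) with hs
  have hs0 : 0 ≤ s := Real.sqrt_nonneg _
  have hs2 : s ^ 2 = 1 - ‖b‖ ^ 2 := Real.sq_sqrt (by nlinarith [norm_nonneg b])
  have hs1 : ((1 + s : ℝ) : ℂ) ≠ 0 := by
    have : (1 + s) ≠ 0 := by positivity
    exact_mod_cast this
  have hbb : (inner ℂ b b : ℂ) = (1 - s) * ((1 + s : ℝ) : ℂ) := by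
    rw [inner_self_eq_norm_sq_to_K]
    have : ‖b‖ ^ 2 = (1 - s) * (1 + s) := by linear_combination hs2
    have h2 : (((‖b‖ ^ 2 : ℝ)) : ℂ) = (((1 - s) * (1 + s) : ℝ) : ℂ) := by rw [this]
    push_cast at h2 ⊢
    exact h2
  simp only [inner_smul_right, inner_sub_right, inner_add_right, hbb]
  field_simp
  push_cast
  ring

open scoped Matrix in
theorem exists_ballAut_jacobian {n : ℕ} {b z : EuclideanSpace ℂ (Fin n)} (hb : ‖b‖ < 1)
    (hz : ‖z‖ ≤ 1) : ∃ J : Matrix (Fin n) (Fin n) ℂ,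
      (∀ ξ : EuclideanSpace ℂ (Fin n),
        HasDerivAt (fun ζ : ℂ => ballAut b (z + ζ • ξ)) (WithLp.toLp 2 (J *ᵥ ξ.ofLp)) 0) ∧
      J.det = ballAutScale b z ^ (n + 1) := by
  set a := ballAutScale b z with ha
  set w := ballAutDir b z with hw
  have hd := one_add_inner_ne_zero hb hz
  have hs : ((Real.sqrt (1 - ‖b‖ ^ 2) : ℝ) : ℂ) ≠ 0 := by
    have : 0 < Real.sqrt (1 - ‖b‖ ^ 2) := Real.sqrt_pos.2 (by nlinarith [norm_nonneg b])
    exact_mod_cast this.ne'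
  have ha0 : a ≠ 0 := div_ne_zero hs hd
  have hin : ∀ ξ : EuclideanSpace ℂ (Fin n), inner ℂ b ξ = star b.ofLp ⬝ᵥ ξ.ofLp := by
    intro ξ
    simp [PiLp.inner_apply, dotProduct, mul_comm]
  refine ⟨a • (1 + Matrix.replicateCol Unit (a⁻¹ • w.ofLp) * Matrix.replicateRow Unit (star b.ofLp)),
    fun ξ => ?_, ?_⟩
  · refine (hasDerivAt_ballAut_line hb hz ξ).congr_deriv ?_
    rw [← ha, ← hw, hin]
    ext i
    simp only [Matrix.smul_mulVec, Matrix.add_mulVec, Matrix.one_mulVec, ← Matrix.mulVec_mulVec,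
      PiLp.add_apply, PiLp.smul_apply, Pi.add_apply, Pi.smul_apply, smul_eq_mul]
    have : (Matrix.replicateCol Unit (a⁻¹ • w.ofLp) *ᵥ Matrix.replicateRow Unit (star b.ofLp) *ᵥ ξ.ofLp) i
        = a⁻¹ * w.ofLp i * (star b.ofLp ⬝ᵥ ξ.ofLp) := by
      simp [Matrix.mulVec, dotProduct]
    rw [this]
    field_simp
  · rw [Matrix.det_smul, Matrix.det_one_add_replicateCol_mul_replicateRow, dotProduct_smul, ← hin,
      Fintype.card_fin, pow_succ, smul_eq_mul]
    congr 1
    have h := inner_ballAutDir hb hz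
    rw [← hw, ← ha] at h
    have haeq : a * (1 + inner ℂ b z) = ((Real.sqrt (1 - ‖b‖ ^ 2) : ℝ) : ℂ) := by
      rw [ha, ballAutScale]; field_simp
    rw [← haeq] at h
    have h2 : inner ℂ b w = a * (a - 1) := by
      apply mul_left_cancel₀ hd
      rw [h]; ring
    rw [h2]
    field_simp
    ring

theorem ballAutWeight_pow {n : ℕ} (hn : 0 < n) {b z : E} (hb : ‖b‖ < 1) :
    ballAutWeight n b z ^ n = ‖ballAutScale b z ^ (n + 1)‖ ^ 2 := by
  have h1 : 0 < 1 - ‖b‖ ^ 2 := by nlinarith [norm_nonneg b]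
  have hn' : (n : ℝ) ≠ 0 := by exact_mod_cast hn.ne'
  rw [ballAutWeight, ← Real.rpow_natCast, ← Real.rpow_mul (by positivity), div_mul_cancel₀ _ hn',
    ← Nat.cast_add_one, Real.rpow_natCast, norm_pow, ballAutScale, norm_div, Complex.norm_real,
    Real.norm_of_nonneg (Real.sqrt_nonneg _), ← pow_mul, mul_comm (n + 1), pow_mul,
    div_pow (Real.sqrt _), Real.sq_sqrt h1.le]

end automorphism

section taylor
variable {X W : Type*} [NormedAddCommGroup X] [NormedSpace ℝ X] [NormedAddCommGroup W]
  [NormedSpace ℝ W]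

theorem norm_taylor_le_of_holder {F : X → W} {s : Set X} (hs : Convex ℝ s) {K α : ℝ} (hK : 0 ≤ K)
    (hα : 0 ≤ α) (hF : ∀ x ∈ s, DifferentiableAt ℝ F x)
    (hF' : ∀ x ∈ s, ∀ y ∈ s, ‖fderiv ℝ F x - fderiv ℝ F y‖ ≤ K * ‖x - y‖ ^ α)
    {x y : X} (hx : x ∈ s) (hy : y ∈ s) :
    ‖F y - F x - fderiv ℝ F x (y - x)‖ ≤ K * ‖y - x‖ ^ α * ‖y - x‖ := by
  have hseg : segment ℝ x y ⊆ s := hs.segment_subset hx hy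
  refine (convex_segment x y).norm_image_sub_le_of_norm_hasFDerivWithin_le' (f' := fderiv ℝ F)
    (fun z hz => (hF z (hseg hz)).hasFDerivAt.hasFDerivWithinAt) (fun z hz => ?_)
    (left_mem_segment ℝ x y) (right_mem_segment ℝ x y)
  refine (hF' z (hseg hz) x hx).trans ?_
  gcongr
  obtain ⟨θ, hθ, rfl⟩ := (segment_eq_image' ℝ x y) ▸ hz
  rw [add_sub_cancel_left, norm_smul, Real.norm_of_nonneg hθ.1]
  exact mul_le_of_le_one_left (norm_nonneg _) hθ.2

theorem exists_bound_secondDifference_of_contDiffAt {F : X → W} {s : Set X} (hs : Convex ℝ s)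
    (hc : IsCompact s) (hF : ∀ x ∈ s, ContDiffAt ℝ 2 F x) :
    ∃ C : ℝ, 0 ≤ C ∧ (∀ x ∈ s, ‖F x‖ ≤ C) ∧
      (∀ x ∈ s, ∀ y ∈ s, ‖F y - F x‖ ≤ C * ‖y - x‖) ∧
      ∀ x d, x ∈ s → x + d ∈ s → x - d ∈ s → ‖F (x + d) + F (x - d) - (2 : ℝ) • F x‖ ≤ C * ‖d‖ ^ 2 := by
  obtain ⟨K, hK⟩ := ContDiffOn.exists_lipschitzOnWith (n := 2)
    (fun x hx => (hF x hx).contDiffWithinAt) (by norm_num) hs hc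
  obtain ⟨L, hL⟩ := ContDiffOn.exists_lipschitzOnWith (f := fderiv ℝ F) (n := 1)
    (fun x hx => ((hF x hx).fderiv_right (m := 1) (by norm_num)).contDiffWithinAt)
    (by norm_num) hs hc
  obtain ⟨B, hB⟩ := hc.exists_bound_of_continuousOn
    (fun x hx => (hF x hx).continuousAt.continuousWithinAt)
  have hB0 : B ≤ |B| := le_abs_self B
  have hK0 : (0 : ℝ) ≤ K := K.2
  have hL0 : (0 : ℝ) ≤ L := L.2
  refine ⟨|B| + K + 2 * L, by positivity, fun x hx => (hB x hx).trans (by linarith), ?_, ?_⟩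
  · intro x hx y hy
    refine (hK.norm_sub_le hy hx).trans ?_
    gcongr
    linarith [abs_nonneg B]
  · intro x d hx hp hm
    have ht : ∀ y ∈ s, ‖F y - F x - fderiv ℝ F x (y - x)‖ ≤ L * ‖y - x‖ ^ 2 := by
      intro y hy
      have := norm_taylor_le_of_holder hs hL0 zero_le_one
        (fun x hx => (hF x hx).differentiableAt (by norm_num)) (fun x hx y hy => by
          simpa using hL.norm_sub_le hx hy) hx hy
      rw [Real.rpow_one] at this
      linarith
    have h1 := ht _ hp
    have h2 := ht _ hm
    simp only [add_sub_cancel_left, sub_sub_cancel_left, norm_neg, map_neg] at h1 h2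
    have h3 : F (x + d) + F (x - d) - (2 : ℝ) • F x
        = (F (x + d) - F x - fderiv ℝ F x d) + (F (x - d) - F x - -fderiv ℝ F x d) := by module
    rw [h3]
    refine (norm_add_le _ _).trans ?_
    nlinarith [abs_nonneg B, sq_nonneg ‖d‖, mul_nonneg (abs_nonneg B) (sq_nonneg ‖d‖),
      mul_nonneg hK0 (sq_nonneg ‖d‖)]

theorem abs_secondDifference_le_of_holder {q : X → ℝ} {s : Set X} (hs : Convex ℝ s) {K L α : ℝ}
    (hL : 0 ≤ L) (hα : 0 ≤ α) (hq : ∀ x ∈ s, DifferentiableAt ℝ q x)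
    (hK : ∀ x ∈ s, ‖fderiv ℝ q x‖ ≤ K)
    (hq' : ∀ x ∈ s, ∀ y ∈ s, ‖fderiv ℝ q x - fderiv ℝ q y‖ ≤ L * ‖x - y‖ ^ α)
    {x y z : X} (hx : x ∈ s) (hy : y ∈ s) (hz : z ∈ s) {δ ε : ℝ} (hyδ : ‖y - x‖ ≤ δ)
    (hzδ : ‖z - x‖ ≤ δ) (hε : ‖y + z - (2 : ℝ) • x‖ ≤ ε) :
    |q y + q z - 2 * q x| ≤ K * ε + 2 * L * (δ ^ α * δ) := by
  have hK0 : 0 ≤ K := (norm_nonneg _).trans (hK x hx)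
  have hδ : 0 ≤ δ := (norm_nonneg _).trans hyδ
  have ht : ∀ w ∈ s, ‖w - x‖ ≤ δ → |q w - q x - fderiv ℝ q x (w - x)| ≤ L * (δ ^ α * δ) := by
    intro w hw hwδ
    refine (norm_taylor_le_of_holder hs hL hα hq hq' hx hw).trans ?_
    rw [mul_assoc]
    gcongr
  have h1 : |fderiv ℝ q x (y + z - (2 : ℝ) • x)| ≤ K * ε :=
    ((fderiv ℝ q x).le_opNorm _).trans (mul_le_mul (hK x hx) hε (norm_nonneg _) hK0)
  have h2 : q y + q z - 2 * q x = (q y - q x - fderiv ℝ q x (y - x))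
      + (q z - q x - fderiv ℝ q x (z - x)) + fderiv ℝ q x (y + z - (2 : ℝ) • x) := by
    simp only [map_sub, map_add, map_smul, smul_eq_mul]
    ring
  rw [h2]
  refine (abs_add_three _ _ _).trans ?_
  linarith [ht y hy hyδ, ht z hz hzδ]
end taylor

section comparison
variable {n : ℕ}

open scoped Matrix in
theorem exists_posSemidef_comp_ballAut (hn : 0 < n) {r : ℝ} (hr : 0 < r)
    {u g : EuclideanSpace ℂ (Fin n) → ℝ} (hu : ContDiffOn ℝ 2 u (ball 0 r))
    (hMA : ∀ p ∈ ball (0 : EuclideanSpace ℂ (Fin n)) r, ∃ A : Matrix (Fin n) (Fin n) ℂ,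
      A.PosSemidef ∧ A.det = ((g p ^ n : ℝ) : ℂ) ∧
      ∀ ξ : EuclideanSpace ℂ (Fin n), 4 * (star ξ.ofLp ⬝ᵥ A *ᵥ ξ.ofLp).re = leviForm u p ξ)
    {b z : EuclideanSpace ℂ (Fin n)} (hb : ‖b‖ < 1) (hz : ‖z‖ < 1) :
    ∃ M : Matrix (Fin n) (Fin n) ℂ, M.PosSemidef ∧
      M.det = (((r ^ 2 * ballAutWeight n b z * g (r • ballAut b z)) ^ n : ℝ) : ℂ) ∧
      ∀ ξ : EuclideanSpace ℂ (Fin n),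
        HasFourPointLimit (fun ζ : ℂ => u (r • ballAut b (z + ζ • ξ)))
          (4 * (star ξ.ofLp ⬝ᵥ M *ᵥ ξ.ofLp).re) := by
  have hp : r • ballAut b z ∈ ball (0 : EuclideanSpace ℂ (Fin n)) r := by
    rw [mem_ball_zero_iff, norm_smul, Real.norm_of_nonneg hr.le]
    nlinarith [norm_ballAut_lt_one hb hz]
  obtain ⟨A, hA, hAdet, hAξ⟩ := hMA _ hp
  obtain ⟨J, hJ, hJdet⟩ := exists_ballAut_jacobian hb hz.le
  set B : Matrix (Fin n) (Fin n) ℂ := (r : ℂ) • J with hB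
  refine ⟨Bᴴ * A * B, hA.conjTranspose_mul_mul_same B, ?_, fun ξ => ?_⟩
  · have h2 : ballAutWeight n b z ^ n = _ := ballAutWeight_pow hn hb
    have h3 : ((‖ballAutScale b z ^ (n + 1)‖ ^ 2 : ℝ) : ℂ)
        = star (ballAutScale b z ^ (n + 1)) * ballAutScale b z ^ (n + 1) := by
      rw [← Complex.normSq_eq_norm_sq, Complex.normSq_eq_conj_mul_self]
      rfl
    rw [Matrix.det_mul, Matrix.det_mul, Matrix.det_conjTranspose, hAdet, hB, Matrix.det_smul, hJdet,
      mul_pow, mul_pow, h2]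
    rw [Complex.ofReal_mul, Complex.ofReal_mul, h3, Fintype.card_fin]
    simp only [star_mul', star_pow, Complex.ofReal_pow, RCLike.star_def, Complex.conj_ofReal]
    ring
  · have hline : Continuous (fun ζ : ℂ => z + ζ • ξ) := by fun_prop
    have hev : ∀ᶠ ζ : ℂ in 𝓝 0, ‖z + ζ • ξ‖ < 1 :=
      hline.norm.continuousAt.eventually_lt continuousAt_const (by simpa using hz)
    have hd : ∀ᶠ ζ : ℂ in 𝓝 0,
        DifferentiableAt ℂ (fun ζ : ℂ => r • ballAut b (z + ζ • ξ)) ζ := by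
      filter_upwards [hev] with ζ hζ
      have h2 := (hasDerivAt_ballAut_line hb hζ.le ξ)
      have h3 : DifferentiableAt ℂ (fun η : ℂ => ballAut b (z + η • ξ)) ζ := by
        have h4 : HasDerivAt (fun η : ℂ => η - ζ) 1 ζ := (hasDerivAt_id ζ).sub_const ζ
        have h5 := HasDerivAt.scomp (g₁ := fun η : ℂ => ballAut b (z + ζ • ξ + η • ξ)) ζ
          (by simpa using h2) h4
        refine h5.differentiableAt.congr_of_eventuallyEq (Eventually.of_forall fun η => ?_)
        simp only [Function.comp]
        congr 1
        module
      exact h3.const_smul r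
    have hder : deriv (fun ζ : ℂ => r • ballAut b (z + ζ • ξ)) 0 = WithLp.toLp 2 (B *ᵥ ξ.ofLp) := by
      refine ((hJ ξ).const_smul r).deriv.trans ?_
      rw [hB, Matrix.smul_mulVec]
      rfl
    have h0 : r • ballAut b (z + (0 : ℂ) • ξ) = r • ballAut b z := by simp
    have := hasFourPointLimit_comp (u := u) (γ := fun ζ : ℂ => r • ballAut b (z + ζ • ξ))
      (by simpa using hu.contDiffAt (isOpen_ball.mem_nhds hp)) hd
    rw [hder, h0, ← hAξ] at this
    convert this using 3
    rw [← Matrix.mulVec_mulVec, ← Matrix.mulVec_mulVec, Matrix.dotProduct_mulVec,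
      Matrix.star_mulVec]

theorem continuousOn_comp_ballAut {r : ℝ} (hr : 0 < r) {u : EuclideanSpace ℂ (Fin n) → ℝ}
    (hu : ContinuousOn u (closedBall 0 r)) {b : EuclideanSpace ℂ (Fin n)} (hb : ‖b‖ < 1) :
    ContinuousOn (fun z => u (r • ballAut b z)) (closedBall 0 1) := by
  refine hu.comp (t := closedBall 0 r) (fun z hz => ?_) (fun z hz => ?_)
  · have : ContinuousAt (fun z => ballAut b z) z :=
      (contDiffAt_ballAut hb (mem_closedBall_zero_iff.1 hz)).continuousAt.comp
        (f := fun z => (b, z)) (by fun_prop)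
    exact (this.const_smul r).continuousWithinAt
  · rw [mem_closedBall_zero_iff, norm_smul, Real.norm_of_nonneg hr.le]
    exact mul_le_of_le_one_right hr.le (norm_ballAut_le_one hb (mem_closedBall_zero_iff.1 hz))

theorem secondDifference_le_of_comparison (hn : 0 < n) {r : ℝ} (hr : 0 < r)
    {u g : EuclideanSpace ℂ (Fin n) → ℝ} (hu : ContDiffOn ℝ 2 u (ball 0 r))
    (huc : ContinuousOn u (closedBall 0 r))
    (hg : ∀ p ∈ ball (0 : EuclideanSpace ℂ (Fin n)) r, 0 ≤ g p)
    (hMA : ∀ p ∈ ball (0 : EuclideanSpace ℂ (Fin n)) r, ∃ A : Matrix (Fin n) (Fin n) ℂ,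
      A.PosSemidef ∧ A.det = ((g p ^ n : ℝ) : ℂ) ∧
      ∀ ξ : EuclideanSpace ℂ (Fin n), 4 * (star ξ.ofLp ⬝ᵥ A.mulVec ξ.ofLp).re = leviForm u p ξ)
    {b b₁ b₂ : EuclideanSpace ℂ (Fin n)} (hb : ‖b‖ < 1) (hb₁ : ‖b₁‖ < 1) (hb₂ : ‖b₂‖ < 1)
    {m c : ℝ} (hc : 0 < c)
    (hbdry : ∀ z, ‖z‖ = 1 →
      u (r • ballAut b₁ z) + u (r • ballAut b₂ z) - 2 * u (r • ballAut b z) ≤ m)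
    (hgc : ∀ z, ‖z‖ < 1 → 2 * (r ^ 2 * ballAutWeight n b z * g (r • ballAut b z))
      < r ^ 2 * ballAutWeight n b₁ z * g (r • ballAut b₁ z)
        + r ^ 2 * ballAutWeight n b₂ z * g (r • ballAut b₂ z) + c) :
    u (r • b₁) + u (r • b₂) - 2 * u (r • b) ≤ m + c := by
  have : Nonempty (Fin n) := ⟨⟨0, hn⟩⟩
  set w : EuclideanSpace ℂ (Fin n) → ℝ := fun z => u (r • ballAut b₁ z) + u (r • ballAut b₂ z)
    + (c * ‖z‖ ^ 2 + (-2) * u (r • ballAut b z)) with hw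
  have hwc : ContinuousOn w (closedBall 0 1) :=
    ((continuousOn_comp_ballAut hr huc hb₁).add (continuousOn_comp_ballAut hr huc hb₂)).add
      ((by fun_prop : ContinuousOn (fun z : EuclideanSpace ℂ (Fin n) => c * ‖z‖ ^ 2) _).add
        ((continuousOn_comp_ballAut hr huc hb).const_smul (-2 : ℝ)))
  obtain ⟨z, hz, hmax⟩ := (isCompact_closedBall (0 : EuclideanSpace ℂ (Fin n)) 1).exists_isMaxOn
    ⟨0, by simp⟩ hwc
  have hz' := mem_closedBall_zero_iff.1 hz
  have h0 : w 0 ≤ w z := hmax (by simp)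
  have hw0 : w 0 = u (r • b₁) + u (r • b₂) - 2 * u (r • b) := by
    simp only [hw, ballAut_zero, norm_zero]
    ring
  rw [← hw0]
  rcases hz'.eq_or_lt with h1 | h1
  · have := hbdry z h1
    have hwz : w z = u (r • ballAut b₁ z) + u (r • ballAut b₂ z) - 2 * u (r • ballAut b z) + c := by
      simp only [hw, h1]
      ring
    linarith
  exfalso
  have hpos : ∀ d : EuclideanSpace ℂ (Fin n), ‖d‖ < 1 →
      0 ≤ r ^ 2 * ballAutWeight n d z * g (r • ballAut d z) := by
    intro d hd
    refine mul_nonneg (mul_nonneg (sq_nonneg r) (ballAutWeight_nonneg n hd z)) (hg _ ?_)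
    rw [mem_ball_zero_iff, norm_smul, Real.norm_of_nonneg hr.le]
    nlinarith [norm_ballAut_lt_one hd h1]
  obtain ⟨A, hA, hAd, hAl⟩ := exists_posSemidef_comp_ballAut hn hr hu hMA hb h1
  obtain ⟨M, hM, hMd, hMl⟩ := exists_posSemidef_comp_ballAut hn hr hu hMA hb₁ h1
  obtain ⟨N, hN, hNd, hNl⟩ := exists_posSemidef_comp_ballAut hn hr hu hMA hb₂ h1
  refine (hgc z h1).not_ge (add_le_of_quadraticForm_le (A := (2 : ℂ) • A) (M := M) (N := N)
    (hA.smul (by simp : (0 : ℂ) ≤ 2)) hM hN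
    (mul_nonneg zero_le_two (hpos b hb)) (hpos b₁ hb₁) (hpos b₂ hb₂) hc ?_ ?_ ?_ fun ξ => ?_)
  · rw [Matrix.det_smul, hAd, mul_pow]
    simp
    ring
  · simpa using hMd
  · simpa using hNd
  · have hlim := ((hMl (WithLp.toLp 2 ξ)).add (hNl (WithLp.toLp 2 ξ))).add
      (((hasFourPointLimit_normSq z (WithLp.toLp 2 ξ)).const_mul c).add
        ((hAl (WithLp.toLp 2 ξ)).const_mul (-2)))
    have hline : Continuous (fun ζ : ℂ => z + ζ • (WithLp.toLp 2 ξ : EuclideanSpace ℂ (Fin n))) := by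
      fun_prop
    have hev : ∀ᶠ ζ : ℂ in 𝓝 0, ‖z + ζ • (WithLp.toLp 2 ξ : EuclideanSpace ℂ (Fin n))‖ < 1 :=
      hline.norm.continuousAt.eventually_lt continuousAt_const (by simpa using h1)
    have hle := hlim.nonpos_of_isMaxOn (by
      filter_upwards [hev] with ζ hζ
      have := hmax (mem_closedBall_zero_iff.2 hζ.le)
      simpa [hw] using this)
    have hnorm : (star ξ ⬝ᵥ ξ).re = ‖(WithLp.toLp 2 ξ : EuclideanSpace ℂ (Fin n))‖ ^ 2 := by
      rw [EuclideanSpace.norm_sq_eq]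
      simp [dotProduct, Complex.sq_norm, Complex.normSq_apply]
    rw [hnorm, Matrix.smul_mulVec, dotProduct_smul]
    simp only [smul_eq_mul, Complex.mul_re, Complex.re_ofNat, Complex.im_ofNat, zero_mul, sub_zero]
    linarith
end comparison

section secondDifference
variable {n : ℕ}

theorem exists_ballAut_bounds (n : ℕ) {ρ : ℝ} (hρ : ρ < 1) :
    ∃ C : ℝ, 0 ≤ C ∧ ∀ b h z : EuclideanSpace ℂ (Fin n), ‖b‖ ≤ ρ → ‖b + h‖ ≤ ρ → ‖b - h‖ ≤ ρ →
      ‖z‖ ≤ 1 →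
      (‖ballAut (b + h) z - ballAut b z‖ ≤ C * ‖h‖ ∧ ‖ballAut (b - h) z - ballAut b z‖ ≤ C * ‖h‖ ∧
        ‖ballAut (b + h) z + ballAut (b - h) z - (2 : ℝ) • ballAut b z‖ ≤ C * ‖h‖ ^ 2) ∧
      |ballAutWeight n b z| ≤ C ∧
      |ballAutWeight n (b + h) z - ballAutWeight n b z| ≤ C * ‖h‖ ∧
      |ballAutWeight n (b - h) z - ballAutWeight n b z| ≤ C * ‖h‖ ∧
      |ballAutWeight n (b + h) z + ballAutWeight n (b - h) z - 2 * ballAutWeight n b z|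
        ≤ C * ‖h‖ ^ 2 := by
  set E := EuclideanSpace ℂ (Fin n)
  set s : Set (E × E) := closedBall 0 ρ ×ˢ closedBall 0 1 with hs
  have hsc : Convex ℝ s := (convex_closedBall _ _).prod (convex_closedBall _ _)
  have hsk : IsCompact s := (isCompact_closedBall _ _).prod (isCompact_closedBall _ _)
  have hmem : ∀ b z : E, ‖b‖ ≤ ρ → ‖z‖ ≤ 1 → (b, z) ∈ s := fun b z hb hz =>
    ⟨mem_closedBall_zero_iff.2 hb, mem_closedBall_zero_iff.2 hz⟩
  have hs' : ∀ x ∈ s, ‖x.1‖ < 1 ∧ ‖x.2‖ ≤ 1 := fun x hx =>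
    ⟨(mem_closedBall_zero_iff.1 hx.1).trans_lt hρ, mem_closedBall_zero_iff.1 hx.2⟩
  obtain ⟨C, hC, -, hL, hD⟩ := exists_bound_secondDifference_of_contDiffAt hsc hsk
    (F := fun x : E × E => ballAut x.1 x.2) fun x hx => contDiffAt_ballAut (hs' x hx).1 (hs' x hx).2
  obtain ⟨C', hC', hB', hL', hD'⟩ := exists_bound_secondDifference_of_contDiffAt hsc hsk
    (F := fun x : E × E => ballAutWeight n x.1 x.2)
    fun x hx => contDiffAt_ballAutWeight n (hs' x hx).1 (hs' x hx).2
  have h1 : ∀ h : E, ‖((h, 0) : E × E)‖ = ‖h‖ := fun h => by simp [Prod.norm_def]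
  refine ⟨C + C', by positivity, fun b h z hb hp hm hz => ?_⟩
  have mb := hmem b z hb hz
  have mp := hmem _ z hp hz
  have mm := hmem _ z hm hz
  have ep : (b, z) + (h, 0) = (b + h, z) := by simp
  have em : (b, z) - (h, 0) = (b - h, z) := by simp
  have fp : (b + h, z) - (b, z) = (h, 0) := by simp
  have fm : (b - h, z) - (b, z) = (-h, 0) := by simp
  have a1 := hL _ mb _ mp
  have a2 := hL _ mb _ mm
  have a3 := hD (b, z) (h, 0) mb (by rwa [ep]) (by rwa [em])
  have a4 := hB' _ mb
  have a5 := hL' _ mb _ mp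
  have a6 := hL' _ mb _ mm
  have a7 := hD' (b, z) (h, 0) mb (by rwa [ep]) (by rwa [em])
  rw [ep, em, h1] at a3 a7
  rw [fp, h1] at a1 a5
  rw [fm, h1, norm_neg] at a2 a6
  have b1 : C * ‖h‖ ≤ (C + C') * ‖h‖ := by gcongr; linarith
  have b2 : C' * ‖h‖ ≤ (C + C') * ‖h‖ := by gcongr; linarith
  have b3 : C * ‖h‖ ^ 2 ≤ (C + C') * ‖h‖ ^ 2 := by gcongr; linarith
  have b4 : C' * ‖h‖ ^ 2 ≤ (C + C') * ‖h‖ ^ 2 := by gcongr; linarith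
  exact ⟨⟨a1.trans b1, a2.trans b1, a3.trans b3⟩, a4.trans (by linarith), a5.trans b2, a6.trans b2,
    a7.trans b4⟩

theorem weighted_secondDifference_le {G G₁ G₂ γ γ₁ γ₂ C D K₀ L s : ℝ}
    (hG : |G| ≤ C) (hG₁ : |G₁ - G| ≤ C * D) (hG₂ : |G₂ - G| ≤ C * D)
    (hGs : |G₁ + G₂ - 2 * G| ≤ C * D ^ 2) (hγ : |γ| ≤ K₀) (hγ₁ : |γ₁ - γ| ≤ L) (hγ₂ : |γ₂ - γ| ≤ L)
    (hγs : |γ₁ + γ₂ - 2 * γ| ≤ s) :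
    2 * (G * γ) ≤ G₁ * γ₁ + G₂ * γ₂ + (C * s + 2 * (C * D * L) + C * D ^ 2 * K₀) := by
  have e : ∀ {a b A B : ℝ}, |a| ≤ A → |b| ≤ B → -(A * B) ≤ a * b := fun {a b A B} ha hb => by
    have := mul_le_mul ha hb (abs_nonneg b) ((abs_nonneg a).trans ha)
    rw [← abs_mul] at this
    linarith [neg_abs_le (a * b)]
  linarith [e hG hγs, e hG₁ hγ₁, e hG₂ hγ₂, e hGs hγ]

theorem comparison_error_le {r α C D K K₀ K₁ K₂ : ℝ} (hr : 0 < r) (hα0 : 0 < α) (hα1 : α < 1)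
    (hC : 0 ≤ C) (hD0 : 0 ≤ D) (hh1 : D ≤ 1) (hK : 0 ≤ K) (hK₀ : 0 ≤ K₀) (hK₁ : 0 ≤ K₁)
    (hK₂ : 0 ≤ K₂) :
    K * r ^ α * (r * (C * D ^ 2)) + 2 * K * ((r * (C * D)) ^ α * (r * (C * D)))
      + r ^ 2 * (C * (K₁ * (r * (C * D ^ 2)) + 2 * K₂ * ((r * (C * D)) ^ α * (r * (C * D))))
        + 2 * (C * D * (K₁ * (r * (C * D)))) + C * D ^ 2 * K₀)
    ≤ (C + 2 * (C ^ α * C) + 3 * C ^ 2 + 2 * C * (C ^ α * C))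
      * (K + r ^ (1 - α) * (K₀ + r * K₁ + r ^ (1 + α) * K₂)) * ((r * D) ^ α * (r * D)) := by
  set P := C ^ α * C with hP
  have hP0 : 0 ≤ P := by positivity
  have hDα : D ≤ D ^ α := by
    simpa using Real.rpow_le_rpow_of_exponent_ge' hD0 hh1 hα0.le hα1.le
  have e1 : (r * (C * D)) ^ α * (r * (C * D)) = r ^ α * r * P * (D ^ α * D) := by
    rw [Real.mul_rpow hr.le (by positivity), Real.mul_rpow hC hD0, hP]
    ring
  have e2 : (r * D) ^ α * (r * D) = r ^ α * r * (D ^ α * D) := by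
    rw [Real.mul_rpow hr.le hD0]
    ring
  have e3 : r ^ (1 - α) * r ^ α = r := by
    rw [← Real.rpow_add hr]
    simp
  have e4 : r ^ (1 + α) = r * r ^ α := by
    rw [Real.rpow_add hr, Real.rpow_one]
  have hDD : D ^ 2 ≤ D ^ α * D := by nlinarith
  rw [e2, e4]
  set s := K₁ * (r * (C * D ^ 2)) + 2 * K₂ * ((r * (C * D)) ^ α * (r * (C * D)))
  set c := C * s + 2 * (C * D * (K₁ * (r * (C * D)))) + C * D ^ 2 * K₀
  set m := K * r ^ α * (r * (C * D ^ 2)) + 2 * K * ((r * (C * D)) ^ α * (r * (C * D)))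
  have hs1 : s ≤ (K₁ * r * C + 2 * K₂ * (r ^ α * r) * P) * (D ^ α * D) := by
    simp only [s]
    rw [e1]
    linarith [mul_le_mul_of_nonneg_left hDD (by positivity : 0 ≤ K₁ * r * C)]
  have hm1 : m ≤ K * (r ^ α * r) * (C + 2 * P) * (D ^ α * D) := by
    simp only [m]
    rw [e1]
    linarith [mul_le_mul_of_nonneg_left hDD (by positivity : 0 ≤ K * (r ^ α * r) * C)]
  have hc1 : c ≤ (C * (K₁ * r * C + 2 * K₂ * (r ^ α * r) * P) + 2 * C ^ 2 * K₁ * r + C * K₀)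
      * (D ^ α * D) := by
    have h1 := mul_le_mul_of_nonneg_left hs1 hC
    have h2 := mul_le_mul_of_nonneg_left hDD (by positivity : 0 ≤ 2 * C ^ 2 * K₁ * r + C * K₀)
    simp only [c]
    linarith
  have hc2 : r ^ 2 * c ≤ r ^ 2 * ((C * (K₁ * r * C + 2 * K₂ * (r ^ α * r) * P)
      + 2 * C ^ 2 * K₁ * r + C * K₀) * (D ^ α * D)) := by gcongr
  have e5 : r ^ 2 = r ^ (1 - α) * (r ^ α * r) := by
    rw [← mul_assoc, e3, sq]
  set q := r ^ (1 - α)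
  set a := r ^ α
  set e := D ^ α * D
  have hq : 0 ≤ q := by positivity
  have ha : 0 ≤ a * r := by positivity
  have he : 0 ≤ e := by positivity
  set C' := C + 2 * P + 3 * C ^ 2 + 2 * C * P with hC'
  have g0 : C + 2 * P ≤ C' := by rw [hC']; linarith [sq_nonneg C, mul_nonneg hC hP0]
  have g1 : 3 * C ^ 2 ≤ C' := by rw [hC']; linarith [mul_nonneg hC hP0]
  have g2 : 2 * C * P ≤ C' := by rw [hC']; linarith [sq_nonneg C]
  have g3 : C ≤ C' := by rw [hC']; linarith [sq_nonneg C, mul_nonneg hC hP0]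
  have f0 := mul_le_mul_of_nonneg_left g0 (by positivity : 0 ≤ K * (a * r) * e)
  have f1 := mul_le_mul_of_nonneg_left g1 (by positivity : 0 ≤ q * (a * r) * e * (K₁ * r))
  have f2 := mul_le_mul_of_nonneg_left g2 (by positivity : 0 ≤ q * (a * r) * e * (K₂ * (a * r)))
  have f3 := mul_le_mul_of_nonneg_left g3 (by positivity : 0 ≤ q * (a * r) * e * K₀)
  rw [e5] at hc2 ⊢
  linarith

theorem secondDifference_le_of_small_gradient (hn : 0 < n) {α ρ : ℝ} (hα0 : 0 < α) (hα1 : α < 1)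
    (hρ : ρ < 1) :
    ∃ C : ℝ, 0 ≤ C ∧ ∀ r : ℝ, 0 < r → ∀ u g Φ : EuclideanSpace ℂ (Fin n) → ℝ,
      ContDiffOn ℝ 2 u (ball 0 r) → ContinuousOn u (closedBall 0 r) →
      (∀ p ∈ ball (0 : EuclideanSpace ℂ (Fin n)) r, 0 ≤ g p) →
      (∀ p ∈ ball (0 : EuclideanSpace ℂ (Fin n)) r, ∃ A : Matrix (Fin n) (Fin n) ℂ,
        A.PosSemidef ∧ A.det = ((g p ^ n : ℝ) : ℂ) ∧
        ∀ ξ : EuclideanSpace ℂ (Fin n),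
          4 * (star ξ.ofLp ⬝ᵥ A.mulVec ξ.ofLp).re = leviForm u p ξ) →
      DifferentiableOn ℝ g (ball 0 r) → ContinuousOn Φ (closedBall 0 r) →
      DifferentiableOn ℝ Φ (ball 0 r) →
      (∀ z ∈ sphere (0 : EuclideanSpace ℂ (Fin n)) r, u z = Φ z) →
      ∀ K K₀ K₁ K₂ : ℝ, 0 ≤ K → 0 ≤ K₀ → 0 ≤ K₁ → 0 ≤ K₂ →
      (∀ x ∈ ball (0 : EuclideanSpace ℂ (Fin n)) r, ‖fderiv ℝ Φ x‖ ≤ K * r ^ α) →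
      (∀ x ∈ ball (0 : EuclideanSpace ℂ (Fin n)) r, ∀ y ∈ ball (0 : EuclideanSpace ℂ (Fin n)) r,
        ‖fderiv ℝ Φ x - fderiv ℝ Φ y‖ ≤ K * ‖x - y‖ ^ α) →
      (∀ x ∈ ball (0 : EuclideanSpace ℂ (Fin n)) r, |g x| ≤ K₀) →
      (∀ x ∈ ball (0 : EuclideanSpace ℂ (Fin n)) r, ‖fderiv ℝ g x‖ ≤ K₁) →
      (∀ x ∈ ball (0 : EuclideanSpace ℂ (Fin n)) r, ∀ y ∈ ball (0 : EuclideanSpace ℂ (Fin n)) r,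
        ‖fderiv ℝ g x - fderiv ℝ g y‖ ≤ K₂ * ‖x - y‖ ^ α) →
      ∀ b h : EuclideanSpace ℂ (Fin n), ‖b + h‖ ≤ ρ → ‖b - h‖ ≤ ρ →
        u (r • (b + h)) + u (r • (b - h)) - 2 * u (r • b) ≤
          C * (K + r ^ (1 - α) * (K₀ + r * K₁ + r ^ (1 + α) * K₂)) *
            ((r * ‖h‖) ^ α * (r * ‖h‖)) := by
  obtain ⟨C, hC, hbd⟩ := exists_ballAut_bounds n hρ
  set P := C ^ α * C with hP
  have hP0 : 0 ≤ P := by positivity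
  refine ⟨C + 2 * P + 3 * C ^ 2 + 2 * C * P, by positivity, ?_⟩
  intro r hr u g Φ hu huc hg hMA hgd hΦc hΦd huΦ K K₀ K₁ K₂ hK hK₀ hK₁ hK₂ hΦ' hΦα hgK₀ hgK₁ hgK₂
    b h hp hm
  have hb : ‖b‖ ≤ ρ := by
    have : b = (1 / 2 : ℝ) • (b + h) + (1 / 2 : ℝ) • (b - h) := by module
    rw [this]
    refine (norm_add_le _ _).trans ?_
    rw [norm_smul, norm_smul, Real.norm_of_nonneg (by norm_num)]
    linarith
  have hh1 : ‖h‖ ≤ 1 := by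
    have : h = (1 / 2 : ℝ) • (b + h) - (1 / 2 : ℝ) • (b - h) := by module
    rw [this]
    refine (norm_sub_le _ _).trans ?_
    rw [norm_smul, norm_smul, Real.norm_of_nonneg (by norm_num)]
    linarith
  set D := ‖h‖ with hDdef
  have hD0 : 0 ≤ D := norm_nonneg h
  have hb1 := hb.trans_lt hρ
  have hp1 := hp.trans_lt hρ
  have hm1 := hm.trans_lt hρ
  have hball : ∀ d z : EuclideanSpace ℂ (Fin n), ‖d‖ < 1 → ‖z‖ < 1 →
      r • ballAut d z ∈ ball (0 : EuclideanSpace ℂ (Fin n)) r := by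
    intro d z hd hz
    rw [mem_ball_zero_iff, norm_smul, Real.norm_of_nonneg hr.le]
    exact mul_lt_of_lt_one_right hr (norm_ballAut_lt_one hd hz)
  have hT1 : ∀ z : EuclideanSpace ℂ (Fin n), ‖z‖ ≤ 1 →
      ‖r • ballAut (b + h) z - r • ballAut b z‖ ≤ r * (C * D) := by
    intro z hz
    rw [← smul_sub, norm_smul, Real.norm_of_nonneg hr.le]
    exact mul_le_mul_of_nonneg_left (hbd b h z hb hp hm hz).1.1 hr.le
  have hT2 : ∀ z : EuclideanSpace ℂ (Fin n), ‖z‖ ≤ 1 →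
      ‖r • ballAut (b - h) z - r • ballAut b z‖ ≤ r * (C * D) := by
    intro z hz
    rw [← smul_sub, norm_smul, Real.norm_of_nonneg hr.le]
    exact mul_le_mul_of_nonneg_left (hbd b h z hb hp hm hz).1.2.1 hr.le
  have hT3 : ∀ z : EuclideanSpace ℂ (Fin n), ‖z‖ ≤ 1 →
      ‖r • ballAut (b + h) z + r • ballAut (b - h) z - (2 : ℝ) • (r • ballAut b z)‖
        ≤ r * (C * D ^ 2) := by
    intro z hz
    rw [smul_comm (2 : ℝ) r, ← smul_add, ← smul_sub, norm_smul, Real.norm_of_nonneg hr.le]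
    exact mul_le_mul_of_nonneg_left (hbd b h z hb hp hm hz).1.2.2 hr.le
  have hcv : Convex ℝ (ball (0 : EuclideanSpace ℂ (Fin n)) r) := convex_ball _ _
  have hdΦ : ∀ x ∈ ball (0 : EuclideanSpace ℂ (Fin n)) r, DifferentiableAt ℝ Φ x := fun x hx =>
    hΦd.differentiableAt (isOpen_ball.mem_nhds hx)
  have hdg : ∀ x ∈ ball (0 : EuclideanSpace ℂ (Fin n)) r, DifferentiableAt ℝ g x := fun x hx =>
    hgd.differentiableAt (isOpen_ball.mem_nhds hx)
  set m := K * r ^ α * (r * (C * D ^ 2)) + 2 * K * ((r * (C * D)) ^ α * (r * (C * D))) with hmdef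
  have hbdry : ∀ z : EuclideanSpace ℂ (Fin n), ‖z‖ = 1 → u (r • ballAut (b + h) z)
      + u (r • ballAut (b - h) z) - 2 * u (r • ballAut b z) ≤ m := by
    intro z hz
    have hsph : ∀ d : EuclideanSpace ℂ (Fin n), ‖d‖ < 1 →
        u (r • ballAut d z) = Φ (r • ballAut d z) := by
      intro d hd
      refine huΦ _ ?_
      rw [mem_sphere_zero_iff_norm, norm_smul, norm_ballAut_eq_one hd hz, mul_one,
        Real.norm_of_nonneg hr.le]
    have hc : ∀ d : EuclideanSpace ℂ (Fin n), ‖d‖ < 1 →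
        ContinuousOn (fun z => Φ (r • ballAut d z)) (closedBall 0 1) :=
      fun d hd => continuousOn_comp_ballAut hr hΦc hd
    rw [hsph _ hp1, hsph _ hm1, hsph _ hb1]
    have hcl : closure (ball (0 : EuclideanSpace ℂ (Fin n)) 1) = closedBall 0 1 :=
      closure_ball _ one_ne_zero
    refine le_on_closure (s := ball (0 : EuclideanSpace ℂ (Fin n)) 1)
      (f := fun z => Φ (r • ballAut (b + h) z) + Φ (r • ballAut (b - h) z)
        - 2 * Φ (r • ballAut b z)) (g := fun _ => m) (fun y hy => ?_) ?_ continuousOn_const ?_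
    · have hy1 := mem_ball_zero_iff.1 hy
      exact (le_abs_self _).trans (abs_secondDifference_le_of_holder hcv hK hα0.le hdΦ hΦ' hΦα
        (hball _ _ hb1 hy1) (hball _ _ hp1 hy1) (hball _ _ hm1 hy1) (hT1 y hy1.le) (hT2 y hy1.le)
        (hT3 y hy1.le))
    · rw [hcl]
      exact ((hc _ hp1).add (hc _ hm1)).sub ((hc _ hb1).const_smul (2 : ℝ))
    · rw [hcl]
      exact mem_closedBall_zero_iff.2 hz.le
  set s := K₁ * (r * (C * D ^ 2)) + 2 * K₂ * ((r * (C * D)) ^ α * (r * (C * D))) with hsdef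
  set c := C * s + 2 * (C * D * (K₁ * (r * (C * D)))) + C * D ^ 2 * K₀ with hcdef
  have hs0 : 0 ≤ s := by positivity
  have hc0 : 0 ≤ c := by positivity
  have hgc : ∀ z : EuclideanSpace ℂ (Fin n), ‖z‖ < 1 →
      2 * (ballAutWeight n b z * g (r • ballAut b z))
        ≤ ballAutWeight n (b + h) z * g (r • ballAut (b + h) z)
        + ballAutWeight n (b - h) z * g (r • ballAut (b - h) z) + c := by
    intro z hz
    obtain ⟨-, w1, w2, w3, w4⟩ := hbd b h z hb hp hm hz.le
    have hlip : ∀ d : EuclideanSpace ℂ (Fin n), ‖d‖ < 1 →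
        ‖r • ballAut d z - r • ballAut b z‖ ≤ r * (C * D) →
        |g (r • ballAut d z) - g (r • ballAut b z)| ≤ K₁ * (r * (C * D)) := by
      intro d hd hle
      exact (hcv.norm_image_sub_le_of_norm_fderiv_le (𝕜 := ℝ) hdg hgK₁ (hball b z hb1 hz)
        (hball d z hd hz)).trans (mul_le_mul_of_nonneg_left hle hK₁)
    exact weighted_secondDifference_le w1 w2 w3 w4 (hgK₀ _ (hball b z hb1 hz))
      (hlip _ hp1 (hT1 z hz.le)) (hlip _ hm1 (hT2 z hz.le))
      (abs_secondDifference_le_of_holder hcv hK₂ hα0.le hdg hgK₁ hgK₂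
        (hball _ _ hb1 hz) (hball _ _ hp1 hz) (hball _ _ hm1 hz) (hT1 z hz.le) (hT2 z hz.le)
        (hT3 z hz.le))
  have hmain : u (r • (b + h)) + u (r • (b - h)) - 2 * u (r • b) ≤ m + r ^ 2 * c := by
    refine le_of_forall_pos_le_add fun ε hε => ?_
    rw [add_assoc]
    refine secondDifference_le_of_comparison hn hr hu huc hg hMA hb1 hp1 hm1
      (by positivity) hbdry fun z hz => ?_
    have := mul_le_mul_of_nonneg_left (hgc z hz) (sq_nonneg r)
    linarith
  exact hmain.trans (comparison_error_le hr hα0 hα1 hC hD0 hh1 hK hK₀ hK₁ hK₂)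

theorem leviForm_sub_clm {E : Type*} [NormedAddCommGroup E] [NormedSpace ℂ E] [NormedSpace ℝ E]
    {u : E → ℝ} {p : E} (hu : ∀ᶠ x in 𝓝 p, DifferentiableAt ℝ u x) (ℓ : E →L[ℝ] ℝ) (ξ : E) :
    leviForm (fun x => u x - ℓ x) p ξ = leviForm u p ξ := by
  have h : fderiv ℝ (fun x => u x - ℓ x) =ᶠ[𝓝 p] fun x => fderiv ℝ u x - ℓ := by
    filter_upwards [hu] with x hx
    exact (hx.hasFDerivAt.sub ℓ.hasFDerivAt).fderiv
  unfold leviForm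
  rw [h.fderiv_eq, fderiv_sub_const]

theorem secondDifference_le_of_holder_gradient (hn : 0 < n) {α ρ : ℝ} (hα0 : 0 < α) (hα1 : α < 1)
    (hρ : ρ < 1) :
    ∃ C : ℝ, 0 ≤ C ∧ ∀ r : ℝ, 0 < r → ∀ u g Φ : EuclideanSpace ℂ (Fin n) → ℝ,
      ContDiffOn ℝ 2 u (ball 0 r) → ContinuousOn u (closedBall 0 r) →
      (∀ p ∈ ball (0 : EuclideanSpace ℂ (Fin n)) r, 0 ≤ g p) →
      (∀ p ∈ ball (0 : EuclideanSpace ℂ (Fin n)) r, ∃ A : Matrix (Fin n) (Fin n) ℂ,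
        A.PosSemidef ∧ A.det = ((g p ^ n : ℝ) : ℂ) ∧
        ∀ ξ : EuclideanSpace ℂ (Fin n),
          4 * (star ξ.ofLp ⬝ᵥ A.mulVec ξ.ofLp).re = leviForm u p ξ) →
      DifferentiableOn ℝ g (ball 0 r) → ContinuousOn Φ (closedBall 0 r) →
      DifferentiableOn ℝ Φ (ball 0 r) →
      (∀ z ∈ sphere (0 : EuclideanSpace ℂ (Fin n)) r, u z = Φ z) →
      ∀ K K₀ K₁ K₂ : ℝ, 0 ≤ K → 0 ≤ K₀ → 0 ≤ K₁ → 0 ≤ K₂ →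
      (∀ x ∈ ball (0 : EuclideanSpace ℂ (Fin n)) r, ∀ y ∈ ball (0 : EuclideanSpace ℂ (Fin n)) r,
        ‖fderiv ℝ Φ x - fderiv ℝ Φ y‖ ≤ K * ‖x - y‖ ^ α) →
      (∀ x ∈ ball (0 : EuclideanSpace ℂ (Fin n)) r, |g x| ≤ K₀) →
      (∀ x ∈ ball (0 : EuclideanSpace ℂ (Fin n)) r, ‖fderiv ℝ g x‖ ≤ K₁) →
      (∀ x ∈ ball (0 : EuclideanSpace ℂ (Fin n)) r, ∀ y ∈ ball (0 : EuclideanSpace ℂ (Fin n)) r,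
        ‖fderiv ℝ g x - fderiv ℝ g y‖ ≤ K₂ * ‖x - y‖ ^ α) →
      ∀ x k : EuclideanSpace ℂ (Fin n), ‖x + k‖ ≤ ρ * r → ‖x - k‖ ≤ ρ * r →
        u (x + k) + u (x - k) - 2 * u x ≤
          C * (K + r ^ (1 - α) * (K₀ + r * K₁ + r ^ (1 + α) * K₂)) * (‖k‖ ^ α * ‖k‖) := by
  obtain ⟨C, hC, H⟩ := secondDifference_le_of_small_gradient hn hα0 hα1 hρ
  refine ⟨C, hC, ?_⟩
  intro r hr u g Φ hu huc hg hMA hgd hΦc hΦd huΦ K K₀ K₁ K₂ hK hK₀ hK₁ hK₂ hΦα hgK₀ hgK₁ hgK₂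
    x k hp hm
  set ℓ := fderiv ℝ Φ 0 with hℓ
  have h0 : (0 : EuclideanSpace ℂ (Fin n)) ∈ ball (0 : EuclideanSpace ℂ (Fin n)) r :=
    mem_ball_self hr
  have hdΦ : ∀ y ∈ ball (0 : EuclideanSpace ℂ (Fin n)) r,
      fderiv ℝ (fun y => Φ y - ℓ y) y = fderiv ℝ Φ y - ℓ := fun y hy =>
    ((hΦd.differentiableAt (isOpen_ball.mem_nhds hy)).hasFDerivAt.sub ℓ.hasFDerivAt).fderiv
  have hscale : ∀ y : EuclideanSpace ℂ (Fin n), r • (r⁻¹ • y) = y := fun y =>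
    smul_inv_smul₀ hr.ne' y
  have hnorm : ∀ y : EuclideanSpace ℂ (Fin n), ‖r⁻¹ • y‖ = r⁻¹ * ‖y‖ := fun y => by
    rw [norm_smul, Real.norm_of_nonneg (by positivity)]
  have hle : ∀ y : EuclideanSpace ℂ (Fin n), ‖y‖ ≤ ρ * r → ‖r⁻¹ • y‖ ≤ ρ := fun y hy => by
    rw [hnorm, inv_mul_le_iff₀ hr]
    linarith
  have := H r hr (fun y => u y - ℓ y) g (fun y => Φ y - ℓ y) (hu.sub ℓ.contDiff.contDiffOn)
    (huc.sub ℓ.continuous.continuousOn) hg (fun p hp' => ?_) hgd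
    (hΦc.sub ℓ.continuous.continuousOn) (hΦd.sub ℓ.differentiable.differentiableOn)
    (fun z hz => by rw [huΦ z hz]) K K₀ K₁ K₂ hK hK₀ hK₁ hK₂ (fun y hy => ?_) (fun y hy z hz => ?_)
    hgK₀ hgK₁ hgK₂ (r⁻¹ • x) (r⁻¹ • k) (by rw [← smul_add]; exact hle _ hp)
    (by rw [← smul_sub]; exact hle _ hm)
  · rw [← smul_add, ← smul_sub, hscale, hscale, hscale, hnorm, mul_inv_cancel_left₀ hr.ne',
      map_add, map_sub] at this
    linarith
  · obtain ⟨A, hA, hAd, hAl⟩ := hMA p hp'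
    refine ⟨A, hA, hAd, fun ξ => ?_⟩
    rw [hAl, leviForm_sub_clm]
    filter_upwards [isOpen_ball.mem_nhds hp'] with y hy
    exact (hu.contDiffAt (isOpen_ball.mem_nhds hy)).differentiableAt (by norm_num)
  · rw [hdΦ y hy]
    refine (hΦα y hy 0 h0).trans ?_
    rw [sub_zero]
    have := mem_ball_zero_iff.1 hy
    gcongr
  · rw [hdΦ y hy, hdΦ z hz, sub_sub_sub_cancel_right]
    exact hΦα y hy z hz
end secondDifference

section holderGradient

theorem norm_sub_le_of_locally_holder {X W : Type*} [NormedAddCommGroup X] [NormedSpace ℝ X]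
    [SeminormedAddCommGroup W] {F : X → W} {s : Set X} (hs : Convex ℝ s) {B α δ : ℝ} (hB : 0 ≤ B)
    (hα : 0 ≤ α) (hF : ∀ x ∈ s, ∀ y ∈ s, ‖x - y‖ ≤ δ → ‖F x - F y‖ ≤ B * ‖x - y‖ ^ α)
    {N : ℕ} (hN : 0 < N) {x y : X} (hx : x ∈ s) (hy : y ∈ s) (hxy : ‖x - y‖ ≤ N * δ) :
    ‖F x - F y‖ ≤ N * B * ‖x - y‖ ^ α := by
  have hN' : (0 : ℝ) < N := by exact_mod_cast hN
  set p : ℕ → X := fun i => x + ((i : ℝ) / N) • (y - x) with hp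
  have hps : ∀ i ≤ N, p i ∈ s := fun i hi => by
    refine hs.add_smul_sub_mem hx hy ⟨by positivity, (div_le_one hN').2 (by exact_mod_cast hi)⟩
  have hstep : ∀ i, ‖p i - p (i + 1)‖ = ‖x - y‖ / N := fun i => by
    have : p i - p (i + 1) = (1 / (N : ℝ)) • (x - y) := by
      simp only [hp, Nat.cast_add, Nat.cast_one, add_div]
      module
    rw [this, norm_smul, Real.norm_of_nonneg (by positivity)]
    ring
  have h0 : p 0 = x := by simp [hp]
  have hNy : p N = y := by simp [hp, div_self hN'.ne']
  have := dist_le_range_sum_of_dist_le (f := fun i => F (p i)) (d := fun _ => B * ‖x - y‖ ^ α) N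
    fun {i} hi => by
      rw [dist_eq_norm]
      refine (hF _ (hps i hi.le) _ (hps (i + 1) hi) ?_).trans ?_
      · rw [hstep, div_le_iff₀ hN']
        linarith
      · rw [hstep]
        gcongr
        exact div_le_self (norm_nonneg _) (by exact_mod_cast hN)
  rw [h0, hNy, dist_eq_norm, Finset.sum_const, Finset.card_range, nsmul_eq_mul] at this
  linarith

variable {E : Type*} [NormedAddCommGroup E] [NormedSpace ℝ E]

theorem abs_taylor_le_of_secondDifference {u : E → ℝ} {x k : E} {α M : ℝ} (hα : 0 < α)
    (hu : DifferentiableAt ℝ u x)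
    (h : ∀ s : ℝ, 0 ≤ s → s ≤ 1 → |u (x + s • k) + u x - 2 * u (x + (s / 2) • k)|
      ≤ M * (s ^ α * s)) :
    |u (x + k) - u x - fderiv ℝ u x k| ≤ M / (1 - (2 : ℝ)⁻¹ ^ α) := by
  set q : ℝ := (2 : ℝ)⁻¹ ^ α with hq
  have hq1 : q < 1 := Real.rpow_lt_one (by norm_num) (by norm_num) hα
  have htend : Tendsto (fun c : ℝ => c • (u (x + c⁻¹ • k) - u x)) atTop (𝓝 (fderiv ℝ u x k)) :=
    hu.hasFDerivAt.lim_real k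
  have ht2 : Tendsto (fun m : ℕ => (2 : ℝ) ^ m * (u (x + ((2 : ℝ) ^ m)⁻¹ • k) - u x)) atTop
      (𝓝 (fderiv ℝ u x k)) := htend.comp (tendsto_pow_atTop_atTop_of_one_lt one_lt_two)
  have := dist_le_of_le_geometric_of_tendsto₀ q M hq1 (fun m => ?_) ht2
  · simp only [pow_zero, inv_one, one_smul, one_mul] at this
    exact this
  · have h2 : (0 : ℝ) < 2 ^ m := by positivity
    have h1 := h ((2 : ℝ) ^ m)⁻¹ (by positivity) (inv_le_one_of_one_le₀ (one_le_pow₀ one_le_two))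
    have h3 : ((2 : ℝ) ^ m)⁻¹ / 2 = ((2 : ℝ) ^ (m + 1))⁻¹ := by
      rw [pow_succ, mul_inv]
      rfl
    have h4 : (((2 : ℝ) ^ m)⁻¹) ^ α = q ^ m := by
      rw [hq, ← inv_pow, ← Real.rpow_natCast, ← Real.rpow_natCast, ← Real.rpow_mul (by norm_num),
        ← Real.rpow_mul (by norm_num), mul_comm]
    rw [h3, h4] at h1
    rw [Real.dist_eq]
    have h5 : (2 : ℝ) ^ m * (u (x + ((2 : ℝ) ^ m)⁻¹ • k) - u x)
        - 2 ^ (m + 1) * (u (x + ((2 : ℝ) ^ (m + 1))⁻¹ • k) - u x)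
        = 2 ^ m * (u (x + ((2 : ℝ) ^ m)⁻¹ • k) + u x - 2 * u (x + ((2 : ℝ) ^ (m + 1))⁻¹ • k)) := by
      rw [pow_succ]
      ring
    rw [h5, abs_mul, abs_of_pos h2]
    refine (mul_le_mul_of_nonneg_left h1 h2.le).trans (le_of_eq ?_)
    field_simp

theorem norm_fderiv_sub_le_of_taylor {u : E → ℝ} {x y : E} {α A : ℝ} (hα0 : 0 ≤ α) (hα1 : α ≤ 1)
    (hA : 0 ≤ A) (hxy : x ≠ y)
    (hx : ∀ k : E, ‖k‖ ≤ 2 * ‖x - y‖ → |u (x + k) - u x - fderiv ℝ u x k| ≤ A * (‖k‖ ^ α * ‖k‖))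
    (hy : ∀ k : E, ‖k‖ ≤ ‖x - y‖ → |u (y + k) - u y - fderiv ℝ u y k| ≤ A * (‖k‖ ^ α * ‖k‖)) :
    ‖fderiv ℝ u x - fderiv ℝ u y‖ ≤ 6 * A * ‖x - y‖ ^ α := by
  set d := ‖x - y‖ with hd
  have hd0 : 0 < d := norm_pos_iff.2 (sub_ne_zero.2 hxy)
  have hyx : ‖y - x‖ = d := by rw [norm_sub_rev]
  refine ContinuousLinearMap.opNorm_le_of_unit_norm (by positivity) fun v hv => ?_
  have hdv : ‖d • v‖ = d := by rw [norm_smul, hv, mul_one, Real.norm_of_nonneg hd0.le]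
  have hsum : ‖y - x + d • v‖ ≤ 2 * d := (norm_add_le _ _).trans (by linarith)
  have h1 := hx _ hsum
  have h2 := hx (y - x) (by linarith)
  have h3 := hy (d • v) hdv.le
  have h4 : ‖y - x + d • v‖ ^ α * ‖y - x + d • v‖ ≤ 4 * (d ^ α * d) := by
    have : (2 * d) ^ α ≤ 2 * d ^ α := by
      rw [Real.mul_rpow zero_le_two hd0.le]
      gcongr
      simpa using Real.rpow_le_rpow_of_exponent_le one_le_two hα1
    calc _ ≤ (2 * d) ^ α * (2 * d) := by gcongr
      _ ≤ 2 * d ^ α * (2 * d) := by gcongr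
      _ = _ := by ring
  have h5 := mul_le_mul_of_nonneg_left h4 hA
  rw [hyx, add_sub_cancel] at h2
  rw [hdv] at h3
  rw [← add_assoc, add_sub_cancel] at h1
  simp only [map_add, map_smul, smul_eq_mul] at h1 h3
  rw [Real.norm_eq_abs, sub_apply]
  have h6 : d * |fderiv ℝ u x v - fderiv ℝ u y v| ≤ d * (6 * A * d ^ α) := by
    rw [← abs_of_pos hd0, ← abs_mul, abs_of_pos hd0, abs_le]
    rw [abs_le] at h1 h2 h3
    constructor <;> linarith [h1.1, h1.2, h2.1, h2.2, h3.1, h3.2]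
  exact le_of_mul_le_mul_left h6 hd0

theorem le_secondDifference_of_leviForm_nonneg [NormedSpace ℂ E] [IsScalarTower ℝ ℂ E]
    [CompleteSpace E] {u : E → ℝ} {r R M α : ℝ} (hα : 0 ≤ α) (hM : 0 ≤ M) (hR : R < r)
    (hu : ContDiffOn ℝ 2 u (ball 0 r)) (hlevi : ∀ p ∈ ball (0 : E) r, ∀ ξ, 0 ≤ leviForm u p ξ)
    (hup : ∀ x k : E, ‖x + k‖ ≤ R → ‖x - k‖ ≤ R →
      u (x + k) + u (x - k) - 2 * u x ≤ M * (‖k‖ ^ α * ‖k‖))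
    {x k : E} (hxk : ‖x‖ + 2 * ‖k‖ ≤ R) :
    -(3 * M * (‖k‖ ^ α * ‖k‖)) ≤ u (x + k) + u (x - k) - 2 * u x := by
  set P := ‖k‖ ^ α * ‖k‖ with hP
  have hIk : ‖Complex.I • k‖ = ‖k‖ := by rw [norm_smul, Complex.norm_I, one_mul]
  have hmem : ∀ ζ : ℂ, ‖ζ‖ ≤ 2 → x + ζ • k ∈ ball (0 : E) r := fun ζ hζ => by
    rw [mem_ball_zero_iff]
    refine ((norm_add_le _ _).trans ?_).trans_lt hR
    rw [norm_smul]
    nlinarith [norm_nonneg k]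
  have hlim : ∀ c ζ₀ : ℂ, ‖c‖ = 1 → ‖ζ₀‖ ≤ 2 →
      ∃ d, 0 ≤ d ∧ HasFourPointLimit (fun ζ => u (x + (c * (ζ₀ + ζ)) • k)) d := by
    intro c ζ₀ hc hζ
    have hp : x + (c * (ζ₀ + 0)) • k ∈ ball (0 : E) r := hmem _ (by simpa [hc] using hζ)
    refine ⟨_, ?_, hasFourPointLimit_comp (γ := fun ζ => x + (c * (ζ₀ + ζ)) • k)
      (hu.contDiffAt (isOpen_ball.mem_nhds hp)) (Eventually.of_forall fun z => by fun_prop)⟩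
    exact hlevi _ hp _
  set S : ℂ → ℝ := fun ζ => u (x + (1 * ζ) • k) + u (x + (Complex.I * ζ) • k)
    + (u (x + (-1 * ζ) • k) + u (x + (-Complex.I * ζ) • k)) with hS
  have hSlim : ∀ ζ₀ : ℂ, ‖ζ₀‖ ≤ 2 →
      ∃ d, 0 ≤ d ∧ HasFourPointLimit (fun ζ => S (ζ₀ + ζ)) d := by
    intro ζ₀ hζ
    obtain ⟨d₁, h₁, l₁⟩ := hlim 1 ζ₀ (by simp) hζ
    obtain ⟨d₂, h₂, l₂⟩ := hlim Complex.I ζ₀ (by simp) hζ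
    obtain ⟨d₃, h₃, l₃⟩ := hlim (-1) ζ₀ (by simp) hζ
    obtain ⟨d₄, h₄, l₄⟩ := hlim (-Complex.I) ζ₀ (by simp) hζ
    exact ⟨_, by positivity, (l₁.add l₂).add (l₃.add l₄)⟩
  set U : ℝ → ℝ → ℝ := fun s t => u (x + s • k + t • (Complex.I • k)) with hU
  have hSU : ∀ a b : ℝ, S (a + b * Complex.I) = U a b + U (-b) a + (U (-a) (-b) + U b (-a)) := by
    intro a b
    have e : ∀ c : ℂ, u (x + c • k) = U c.re c.im := fun c => by
      rw [complex_smul_eq, ← add_assoc]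
    simp only [hS, e]
    simp
  have hpair : ∀ s t s' t' : ℝ, |s| + |t| + (|s'| + |t'|) ≤ 2 → |s'| + |t'| ≤ 1 →
      U (s + s') (t + t') + U (s - s') (t - t') ≤ 2 * U s t + M * P := by
    intro s t s' t' h1 h2
    have hn1 : ∀ a b : ℝ, ‖a • k + b • (Complex.I • k)‖ ≤ (|a| + |b|) * ‖k‖ := fun a b => by
      refine (norm_add_le _ _).trans ?_
      rw [norm_smul, norm_smul, hIk, Real.norm_eq_abs, Real.norm_eq_abs, add_mul]
    have hn2 : ‖x + (s • k + t • (Complex.I • k))‖ ≤ ‖x‖ + (|s| + |t|) * ‖k‖ :=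
      (norm_add_le _ _).trans (by linarith [hn1 s t])
    have hn3 := hn1 s' t'
    have hn4 : (|s| + |t| + (|s'| + |t'|)) * ‖k‖ ≤ 2 * ‖k‖ := by gcongr
    have := hup (x + (s • k + t • (Complex.I • k))) (s' • k + t' • (Complex.I • k))
      ((norm_add_le _ _).trans (by linarith)) ((norm_sub_le _ _).trans (by linarith))
    have hn5 : ‖s' • k + t' • (Complex.I • k)‖ ≤ ‖k‖ :=
      hn3.trans (mul_le_of_le_one_left (norm_nonneg k) h2)
    have hn6 : M * (‖s' • k + t' • (Complex.I • k)‖ ^ α * ‖s' • k + t' • (Complex.I • k)‖)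
        ≤ M * P := by
      rw [hP]
      gcongr
    have e1 : x + (s • k + t • (Complex.I • k)) + (s' • k + t' • (Complex.I • k))
        = x + (s + s') • k + (t + t') • (Complex.I • k) := by module
    have e2 : x + (s • k + t • (Complex.I • k)) - (s' • k + t' • (Complex.I • k))
        = x + (s - s') • k + (t - t') • (Complex.I • k) := by module
    rw [e1, e2, ← add_assoc] at this
    simp only [hU]
    linarith
  have hone : ∀ a b : ℝ, |a| = 1 → |b| ≤ 1 →
      (U a b + U a (-b)) + (U (-a) b + U (-a) (-b)) + ((U b a + U (-b) a) + (U b (-a) + U (-b) (-a)))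
        ≤ 2 * (U 1 0 + U (-1) 0) + 4 * U 0 0 + 6 * (M * P) := by
    intro a b ha hb
    have p1 := hpair a 0 0 b (by simp; linarith) (by simpa using hb)
    have p2 := hpair (-a) 0 0 b (by simp; linarith) (by simpa using hb)
    have p3 := hpair 0 a b 0 (by simp; linarith) (by simpa using hb)
    have p4 := hpair 0 (-a) b 0 (by simp; linarith) (by simpa using hb)
    have p5 := hpair 0 0 0 a (by simp; linarith) (by simp [ha])
    have p6 : U a 0 + U (-a) 0 = U 1 0 + U (-1) 0 := by
      rcases (abs_eq zero_le_one).1 ha with rfl | rfl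
      · rfl
      · rw [neg_neg, add_comm]
    simp only [add_zero, zero_add, zero_sub, sub_zero] at p1 p2 p3 p4 p5
    linarith
  have hend : U 1 0 + U (-1) 0 = u (x + k) + u (x - k) ∧ U 0 0 = u x := by
    constructor
    · simp [hU, sub_eq_add_neg]
    · simp [hU]
  refine le_of_forall_pos_le_add fun ε hε => ?_
  set W : ℂ → ℝ := fun ζ => S ζ + (S (starRingEnd ℂ ζ) + ε * ‖ζ‖ ^ 2) with hW
  set Q : Set ℂ := {ζ | |ζ.re| ≤ 1 ∧ |ζ.im| ≤ 1} with hQ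
  have hQ2 : ∀ ζ ∈ Q, ‖ζ‖ ≤ 2 := fun ζ hζ =>
    (Complex.norm_le_abs_re_add_abs_im ζ).trans (by linarith [hζ.1, hζ.2])
  have hQc : IsCompact Q := by
    refine Metric.isCompact_of_isClosed_isBounded ?_
      ((isBounded_closedBall (x := (0 : ℂ)) (r := 2)).subset fun ζ hζ => by simpa using hQ2 ζ hζ)
    exact (isClosed_le Complex.continuous_re.abs continuous_const).inter
      (isClosed_le Complex.continuous_im.abs continuous_const)
  have hF : ∀ c : ℂ, ‖c‖ = 1 → ContinuousOn (fun ζ => u (x + (c * ζ) • k)) (closedBall 0 2) := by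
    intro c hc
    refine hu.continuousOn.comp (by fun_prop) fun ζ hζ => hmem _ ?_
    rw [norm_mul, hc, one_mul]
    exact mem_closedBall_zero_iff.1 hζ
  have hSc : ContinuousOn S (closedBall 0 2) :=
    ((hF 1 (by simp)).add (hF Complex.I (by simp))).add
      ((hF (-1) (by simp)).add (hF (-Complex.I) (by simp)))
  have hWc : ContinuousOn W Q := by
    refine (hSc.mono fun ζ hζ => mem_closedBall_zero_iff.2 (hQ2 ζ hζ)).add
      ((hSc.comp Complex.continuous_conj.continuousOn fun ζ hζ => ?_).add (by fun_prop))
    rw [mem_closedBall_zero_iff, Complex.norm_conj]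
    exact hQ2 ζ hζ
  obtain ⟨z, hz, hmax⟩ := hQc.exists_isMaxOn ⟨0, by simp [hQ]⟩ hWc
  have h0 : W 0 ≤ W z := hmax (by simp [hQ])
  have hW0 : W 0 = 8 * u x := by
    simp [hW, hS]
    ring
  have hWz : W z = (U z.re z.im + U z.re (-z.im)) + (U (-z.re) z.im + U (-z.re) (-z.im))
      + ((U z.im z.re + U (-z.im) z.re) + (U z.im (-z.re) + U (-z.im) (-z.re)))
      + ε * ‖z‖ ^ 2 := by
    have e1 := hSU z.re z.im
    have e2 := hSU z.re (-z.im)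
    rw [Complex.re_add_im] at e1
    have e3 : starRingEnd ℂ z = (z.re : ℂ) + ((-z.im : ℝ) : ℂ) * Complex.I := by
      apply Complex.ext <;> simp
    simp only [hW]
    rw [e3, e1, e2, neg_neg]
    ring
  have hz2 : ‖z‖ ^ 2 ≤ 2 := by
    rw [Complex.sq_norm, Complex.normSq_apply]
    have h1 := abs_le.1 hz.1
    have h2 := abs_le.1 hz.2
    nlinarith
  have hεz : ε * ‖z‖ ^ 2 ≤ ε * 2 := by gcongr
  rcases hz.1.eq_or_lt with h1 | h1
  · have := hone z.re z.im h1 hz.2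
    linarith [hend.1, hend.2]
  rcases hz.2.eq_or_lt with h2 | h2
  · have := hone z.im z.re h2 hz.1
    linarith [hend.1, hend.2]
  exfalso
  obtain ⟨d₁, hd₁, l₁⟩ := hSlim z (hQ2 z hz)
  obtain ⟨d₂, hd₂, l₂⟩ := hSlim (starRingEnd ℂ z) (by rw [Complex.norm_conj]; exact hQ2 z hz)
  have l₃ := (hasFourPointLimit_normSq z (1 : ℂ)).const_mul ε
  have hev : ∀ᶠ ζ : ℂ in 𝓝 0, z + ζ ∈ Q := by
    have hc1 : ContinuousAt (fun ζ : ℂ => |(z + ζ).re|) 0 := by fun_prop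
    have hc2 : ContinuousAt (fun ζ : ℂ => |(z + ζ).im|) 0 := by fun_prop
    filter_upwards [hc1.eventually_lt continuousAt_const (by simpa using h1),
      hc2.eventually_lt continuousAt_const (by simpa using h2)] with ζ a b
    exact ⟨a.le, b.le⟩
  have hle := (l₁.add (l₂.comp_conj.add l₃)).nonpos_of_isMaxOn (by
    filter_upwards [hev] with ζ hζ
    have := hmax hζ
    simpa [hW] using this)
  simp only [norm_one] at hle
  linarith

theorem norm_fderiv_sub_le_of_secondDifference_le [NormedSpace ℂ E] [IsScalarTower ℝ ℂ E]
    [CompleteSpace E] {u : E → ℝ} {r M α t : ℝ} (hα0 : 0 < α) (hα1 : α < 1) (ht0 : 0 < t)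
    (hr : 0 < r) (hM : 0 ≤ M)
    (hu : ContDiffOn ℝ 2 u (ball 0 r)) (hlevi : ∀ p ∈ ball (0 : E) r, ∀ ξ, 0 ≤ leviForm u p ξ)
    (hup : ∀ x k : E, ‖x + k‖ ≤ (1 - t / 2) * r → ‖x - k‖ ≤ (1 - t / 2) * r →
      u (x + k) + u (x - k) - 2 * u x ≤ M * (‖k‖ ^ α * ‖k‖))
    {x y : E} (hx : x ∈ ball (0 : E) ((1 - t) * r)) (hy : y ∈ ball (0 : E) ((1 - t) * r)) :
    ‖fderiv ℝ u x - fderiv ℝ u y‖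
      ≤ ⌈16 / t⌉₊ * (6 * (3 * M / (1 - (2 : ℝ)⁻¹ ^ α))) * ‖x - y‖ ^ α := by
  have htr : 0 < t * r := mul_pos ht0 hr
  have hq1 : (2 : ℝ)⁻¹ ^ α < 1 := Real.rpow_lt_one (by norm_num) (by norm_num) hα0
  set q : ℝ := (2 : ℝ)⁻¹ ^ α
  have hA : 0 ≤ 3 * M / (1 - q) := div_nonneg (by positivity) (by linarith)
  have habs : ∀ x k : E, ‖x‖ + 2 * ‖k‖ ≤ (1 - t / 2) * r →
      |u (x + k) + u (x - k) - 2 * u x| ≤ 3 * M * (‖k‖ ^ α * ‖k‖) := by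
    intro x k hxk
    have hk := norm_nonneg k
    refine abs_le.2 ⟨le_secondDifference_of_leviForm_nonneg hα0.le hM (by linarith) hu hlevi hup hxk,
      (hup x k ((norm_add_le _ _).trans (by linarith)) ((norm_sub_le _ _).trans (by linarith))).trans
      ?_⟩
    have : 0 ≤ M * (‖k‖ ^ α * ‖k‖) := by positivity
    linarith
  have htaylor : ∀ x k : E, ‖x‖ + 2 * ‖k‖ ≤ (1 - t / 2) * r →
      |u (x + k) - u x - fderiv ℝ u x k| ≤ 3 * M / (1 - q) * (‖k‖ ^ α * ‖k‖) := by
    intro x k hxk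
    have hk := norm_nonneg k
    have hxr : x ∈ ball (0 : E) r := mem_ball_zero_iff.2 (by linarith)
    have := abs_taylor_le_of_secondDifference (k := k) (M := 3 * M * (‖k‖ ^ α * ‖k‖)) hα0
      ((hu.contDiffAt (isOpen_ball.mem_nhds hxr)).differentiableAt (by norm_num))
      fun s hs0 hs1 => ?_
    · rwa [mul_div_right_comm] at this
    have hn : ‖(s / 2) • k‖ = s / 2 * ‖k‖ := by
      rw [norm_smul, Real.norm_of_nonneg (by positivity)]
    have hsk : s * ‖k‖ ≤ ‖k‖ := mul_le_of_le_one_left hk hs1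
    have h1 := habs (x + (s / 2) • k) ((s / 2) • k) (by
      have := norm_add_le x ((s / 2) • k)
      rw [hn] at this ⊢
      linarith)
    rw [add_sub_cancel_right, add_assoc, ← add_smul, add_halves, hn] at h1
    refine h1.trans ?_
    have h2 : s / 2 * ‖k‖ ≤ s * ‖k‖ := by gcongr; linarith
    calc 3 * M * ((s / 2 * ‖k‖) ^ α * (s / 2 * ‖k‖))
        ≤ 3 * M * ((s * ‖k‖) ^ α * (s * ‖k‖)) := by gcongr
      _ = 3 * M * (‖k‖ ^ α * ‖k‖) * (s ^ α * s) := by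
        rw [Real.mul_rpow hs0 hk]
        ring
  refine norm_sub_le_of_locally_holder (convex_ball (0 : E) ((1 - t) * r)) (δ := t * r / 8)
    (by positivity) hα0.le (fun x hx y hy hxy => ?_) (Nat.ceil_pos.2 (by positivity)) hx hy ?_
  · rcases eq_or_ne x y with rfl | hne
    · simp [hα0.ne']
    have hx := mem_ball_zero_iff.1 hx
    have hy := mem_ball_zero_iff.1 hy
    exact norm_fderiv_sub_le_of_taylor hα0.le hα1.le hA hne
      (fun k hk => htaylor x k (by linarith)) (fun k hk => htaylor y k (by linarith))
  · have hx := mem_ball_zero_iff.1 hx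
    have hy := mem_ball_zero_iff.1 hy
    calc ‖x - y‖ ≤ 2 * r := (norm_sub_le _ _).trans (by linarith)
      _ = 16 / t * (t * r / 8) := by field_simp; norm_num
      _ ≤ ⌈16 / t⌉₊ * (t * r / 8) := by gcongr; exact Nat.le_ceil _
end holderGradient

theorem nonneg_of_holder_ball {E W : Type*} [NormedAddCommGroup E] [NormedSpace ℝ E] [Nontrivial E]
    [SeminormedAddCommGroup W] {F : E → W} {r K α : ℝ} (hr : 0 < r)
    (h : ∀ x ∈ ball (0 : E) r, ∀ y ∈ ball (0 : E) r, ‖F x - F y‖ ≤ K * ‖x - y‖ ^ α) : 0 ≤ K := by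
  obtain ⟨v, hv⟩ := NormedSpace.exists_lt_norm ℝ E 0
  have hv' : ‖(r / 2 * ‖v‖⁻¹) • v‖ = r / 2 := by
    rw [norm_smul, Real.norm_of_nonneg (by positivity), inv_mul_cancel_right₀ hv.ne']
  have h1 := h ((r / 2 * ‖v‖⁻¹) • v) (by rw [mem_ball_zero_iff, hv']; linarith) 0 (mem_ball_self hr)
  rw [sub_zero, hv'] at h1
  exact nonneg_of_mul_nonneg_left ((norm_nonneg _).trans h1) (by positivity)

end MongeAmpere

/-- **Interior C^{1,α} estimate for the complex Monge–Ampère equation on a ball**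
(Theorem 1.3). If `u ∈ PSH(B_r(0)) ∩ C(B̄_r(0))` is a (classical) solution of
`det(u_{i j̄}) = f` in `B_r(0)`, `u = φ` on `∂B_r(0)`, with `φ ∈ C^{1,α}(∂B_r(0))`,
`f ≥ 0`, `f^{1/n} ∈ C^{1,α}(B̄_r(0))`, `α ∈ (0,1)`, then for every `t ∈ (0,1)`,
`[u]_{1,α;B_{(1-t)r}(0)} ≤ C(n,α,t) ([φ]_{1,α;∂B_r(0)} + r^{1-α} |f^{1/n}|'_{1,α;B_r(0)})`.
The boundary seminorm `[φ]_{1,α;∂B_r}` is the infimum of `[Φ]_{1,α;B_r}` over all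
extensions `Φ ∈ C^{1,α}(B̄_r)` of `φ`, so we quantify over all such extensions `Φ`
(with Hölder constant `KΦ`), and we express all sup-type norms through arbitrary
upper bounds `K₀, K₁, K₂` for `|f^{1/n}|`, `|∇ f^{1/n}|`, `[f^{1/n}]_{1,α}` on `B_r`. -/
theorem interior_C1alpha_estimate (n : ℕ) (hn : 0 < n) (α : ℝ) (hα0 : 0 < α) (hα1 : α < 1)
    (t : ℝ) (ht0 : 0 < t) (ht1 : t < 1) :
    ∃ C : ℝ, ∀ (r : ℝ), 0 < r →
      ∀ u f g Φ : EuclideanSpace ℂ (Fin n) → ℝ,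
      -- u ∈ C²(B_r) ∩ C(B̄_r)
      ContDiffOn ℝ 2 u (ball 0 r) →
      ContinuousOn u (closedBall 0 r) →
      -- u is plurisubharmonic on B_r
      (∀ z ∈ ball (0 : EuclideanSpace ℂ (Fin n)) r, (cxHessian n u z).PosSemidef) →
      -- the complex Monge-Ampère equation det(u_{i j̄}) = f in B_r
      (∀ z ∈ ball (0 : EuclideanSpace ℂ (Fin n)) r, (cxHessian n u z).det = (f z : ℂ)) →
      -- f ≥ 0 and g = f^{1/n}
      (∀ z ∈ closedBall (0 : EuclideanSpace ℂ (Fin n)) r, 0 ≤ f z) →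
      (∀ z ∈ closedBall (0 : EuclideanSpace ℂ (Fin n)) r, g z = f z ^ ((n : ℝ)⁻¹)) →
      -- g = f^{1/n} ∈ C^{1,α}(B̄_r)
      ContinuousOn g (closedBall 0 r) →
      DifferentiableOn ℝ g (ball 0 r) →
      -- Φ ∈ C^{1,α}(B̄_r) is an extension of the boundary datum φ, and u = φ on ∂B_r
      ContinuousOn Φ (closedBall 0 r) →
      DifferentiableOn ℝ Φ (ball 0 r) →
      (∀ z ∈ sphere (0 : EuclideanSpace ℂ (Fin n)) r, u z = Φ z) →
      ∀ KΦ K₀ K₁ K₂ : ℝ,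
      -- KΦ is a Hölder constant for ∇Φ on B_r (so [φ]_{1,α;∂B_r} ≤ KΦ)
      (∀ x ∈ ball (0 : EuclideanSpace ℂ (Fin n)) r,
        ∀ y ∈ ball (0 : EuclideanSpace ℂ (Fin n)) r,
          ‖fderiv ℝ Φ x - fderiv ℝ Φ y‖ ≤ KΦ * ‖x - y‖ ^ α) →
      -- K₀, K₁, K₂ bound the three pieces of |f^{1/n}|'_{1,α;B_r}
      (∀ x ∈ ball (0 : EuclideanSpace ℂ (Fin n)) r, |g x| ≤ K₀) →
      (∀ x ∈ ball (0 : EuclideanSpace ℂ (Fin n)) r, ‖fderiv ℝ g x‖ ≤ K₁) →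
      (∀ x ∈ ball (0 : EuclideanSpace ℂ (Fin n)) r,
        ∀ y ∈ ball (0 : EuclideanSpace ℂ (Fin n)) r,
          ‖fderiv ℝ g x - fderiv ℝ g y‖ ≤ K₂ * ‖x - y‖ ^ α) →
      -- conclusion: [u]_{1,α;B_{(1-t)r}} ≤ C(n,α,t)([φ]_{1,α;∂B_r} + r^{1-α}|f^{1/n}|'_{1,α;B_r})
      ∀ x ∈ ball (0 : EuclideanSpace ℂ (Fin n)) ((1 - t) * r),
      ∀ y ∈ ball (0 : EuclideanSpace ℂ (Fin n)) ((1 - t) * r),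
        ‖fderiv ℝ u x - fderiv ℝ u y‖ ≤
          C * (KΦ + r ^ (1 - α) * (K₀ + r * K₁ + r ^ (1 + α) * K₂)) * ‖x - y‖ ^ α := by
  obtain ⟨C, hC, H⟩ := secondDifference_le_of_holder_gradient hn hα0 hα1
    (by linarith : 1 - t / 2 < 1)
  refine ⟨⌈16 / t⌉₊ * (6 * (3 * C / (1 - (2 : ℝ)⁻¹ ^ α))), ?_⟩
  intro r hr u f g Φ hu huc hpsh hdet hf hgf hgc hgd hΦc hΦd huΦ K K₀ K₁ K₂ hΦα hgK₀ hgK₁ hgK₂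
    x hx y hy
  have : Nonempty (Fin n) := ⟨⟨0, hn⟩⟩
  have h0 : (0 : EuclideanSpace ℂ (Fin n)) ∈ ball (0 : EuclideanSpace ℂ (Fin n)) r :=
    mem_ball_self hr
  have hK : 0 ≤ K := nonneg_of_holder_ball hr hΦα
  have hK₂ : 0 ≤ K₂ := nonneg_of_holder_ball hr hgK₂
  have hK₀ : 0 ≤ K₀ := (abs_nonneg _).trans (hgK₀ 0 h0)
  have hK₁ : 0 ≤ K₁ := (norm_nonneg _).trans (hgK₁ 0 h0)
  have hg : ∀ p ∈ ball (0 : EuclideanSpace ℂ (Fin n)) r, 0 ≤ g p ∧ g p ^ n = f p := by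
    intro p hp
    have hp' := ball_subset_closedBall hp
    rw [hgf p hp']
    exact ⟨Real.rpow_nonneg (hf p hp') _, Real.rpow_inv_natCast_pow (hf p hp') hn.ne'⟩
  have hMA : ∀ p ∈ ball (0 : EuclideanSpace ℂ (Fin n)) r, ∃ A : Matrix (Fin n) (Fin n) ℂ,
      A.PosSemidef ∧ A.det = ((g p ^ n : ℝ) : ℂ) ∧ ∀ ξ : EuclideanSpace ℂ (Fin n),
        4 * (star ξ.ofLp ⬝ᵥ A.mulVec ξ.ofLp).re = leviForm u p ξ := fun p hp =>
    ⟨(cxHessian n u p).transpose, (hpsh p hp).transpose, by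
      rw [Matrix.det_transpose, hdet p hp, (hg p hp).2],
      cxHessian_quadraticForm (hu.contDiffAt (isOpen_ball.mem_nhds hp))⟩
  have hlevi : ∀ p ∈ ball (0 : EuclideanSpace ℂ (Fin n)) r, ∀ ξ, 0 ≤ leviForm u p ξ := by
    intro p hp ξ
    obtain ⟨A, hA, -, hAl⟩ := hMA p hp
    rw [← hAl]
    exact mul_nonneg zero_le_four (hA.re_dotProduct_nonneg _)
  refine (norm_fderiv_sub_le_of_secondDifference_le hα0 hα1 ht0 hr (by positivity) hu hlevi
    (H r hr u g Φ hu huc (fun p hp => (hg p hp).1) hMA hgd hΦc hΦd huΦ K K₀ K₁ K₂ hK hK₀ hK₁ hK₂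
      hΦα hgK₀ hgK₁ hgK₂) hx hy).trans (le_of_eq ?_)
  ring
end

section
/- Let $\Omega$ be a bounded open set in $\mathbb{R}^n$, and let $u\in C^2(\Omega)$ and $f\in C(\Omega)$ satisfy the Poisson equation $\Delta u=f$ on $\Omega$. Then there is a constant $C=C(n)$ depending only on $n$ such that for every $\mu\in(0,1]$: $[u]^*_{1;\Omega}\leq C\,(\mu^{-1}\sup_{\Omega}|u|+\mu\,|f|^{(2)}_{0;\Omega})$. -/
open Metric Set

/-- The Laplacian of `u : ℝⁿ → ℝ`, as the sum of the second derivatives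
in the coordinate directions, computed via real Fréchet derivatives. -/
noncomputable def lapl (n : ℕ) (u : EuclideanSpace ℝ (Fin n) → ℝ)
    (x : EuclideanSpace ℝ (Fin n)) : ℝ :=
  ∑ i : Fin n,
    (fderiv ℝ (fun w => fderiv ℝ u w (EuclideanSpace.single i (1 : ℝ))) x)
      (EuclideanSpace.single i (1 : ℝ))

open Filter Topology in
/-- The second derivative is nonpositive at a local maximum. -/
theorem IsLocalMax.second_deriv_nonpos {g g' : ℝ → ℝ} {g'' a : ℝ} (hmax : IsLocalMax g a)
    (hg : ∀ᶠ t in 𝓝 a, HasDerivAt g (g' t) t) (hg' : HasDerivAt g' g'' a) : g'' ≤ 0 := by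
  by_contra! hpos
  have hderiv : deriv g =ᶠ[𝓝 a] g' := hg.mono fun t ht => ht.deriv
  have hderiv₂ : deriv (deriv g) a = g'' := hderiv.deriv_eq.trans hg'.deriv
  have hmin : IsLocalMin g a :=
    isLocalMin_of_deriv_deriv_pos (hderiv₂ ▸ hpos) hmax.deriv_eq_zero
      hg.self_of_nhds.continuousAt
  have hconst : g =ᶠ[𝓝 a] fun _ => g a := by
    filter_upwards [hmin, hmax] with t h₁ h₂ using le_antisymm h₂ h₁
  have hzero : deriv g =ᶠ[𝓝 a] fun _ => 0 := by
    simpa using hconst.deriv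
  have : deriv (deriv g) a = 0 := by
    rw [hzero.deriv_eq, deriv_const]
  linarith

open Filter Topology in
/-- A function that is nonpositive to the right of a zero has nonpositive derivative there. -/
theorem HasDerivAt.nonpos_of_nonpos_right {h : ℝ → ℝ} {h' ρ : ℝ} (hd : HasDerivAt h h' 0)
    (hρ : 0 < ρ) (h0 : h 0 = 0) (hle : ∀ t, 0 < t → t < ρ → h t ≤ 0) : h' ≤ 0 := by
  have hlim := (hasDerivWithinAt_iff_tendsto_slope' (s := Ioi 0) (by simp)).1
    hd.hasDerivWithinAt
  refine le_of_tendsto hlim ?_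
  filter_upwards [Ioo_mem_nhdsGT hρ] with t ht
  rw [slope_def_field, h0, sub_zero, sub_zero]
  exact div_nonpos_of_nonpos_of_nonneg (hle t ht.1 ht.2) ht.1.le

theorem ContDiffOn.hasDerivAt_comp_line {E : Type*} [NormedAddCommGroup E] [NormedSpace ℝ E]
    {Ω : Set E} (hΩ : IsOpen Ω) {u : E → ℝ} (hu : ContDiffOn ℝ 2 u Ω) {q v : E} {t : ℝ}
    (hq : q + t • v ∈ Ω) :
    HasDerivAt (fun s : ℝ => u (q + s • v)) (fderiv ℝ u (q + t • v) v) t := by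
  have h := ((hu.differentiableOn (by norm_num)).differentiableAt (hΩ.mem_nhds hq)).hasFDerivAt
  have hl : HasDerivAt (fun s : ℝ => q + s • v) v t := by
    simpa using ((hasDerivAt_id t).smul_const v).const_add q
  exact h.comp_hasDerivAt t hl

theorem ContDiffOn.hasDerivAt_fderiv_comp_line {E : Type*} [NormedAddCommGroup E]
    [NormedSpace ℝ E] {Ω : Set E} (hΩ : IsOpen Ω) {u : E → ℝ} (hu : ContDiffOn ℝ 2 u Ω) {q v : E}
    (hq : q ∈ Ω) :
    HasDerivAt (fun s : ℝ => fderiv ℝ u (q + s • v) v)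
      (fderiv ℝ (fun w => fderiv ℝ u w v) q v) 0 := by
  have h1 : ContDiffOn ℝ 1 (fderiv ℝ u) Ω := hu.fderiv_of_isOpen hΩ (by norm_num)
  have h2 : DifferentiableAt ℝ (fderiv ℝ u) q :=
    (h1.differentiableOn (by norm_num)).differentiableAt (hΩ.mem_nhds hq)
  have h3 : HasFDerivAt (fun w => fderiv ℝ u w v) (fderiv ℝ (fun w => fderiv ℝ u w v) q)
      (q + (0 : ℝ) • v) := by
    simpa using (h2.clm_apply (differentiableAt_const v)).hasFDerivAt
  have hl : HasDerivAt (fun s : ℝ => q + s • v) v 0 := by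
    simpa using ((hasDerivAt_id (0 : ℝ)).smul_const v).const_add q
  exact h3.comp_hasDerivAt 0 hl

theorem fderiv_fderiv_apply_neg {E : Type*} [NormedAddCommGroup E] [NormedSpace ℝ E]
    (u : E → ℝ) (q v : E) :
    fderiv ℝ (fun w => fderiv ℝ u w (-v)) q (-v) = fderiv ℝ (fun w => fderiv ℝ u w v) q v := by
  simp [fderiv_fun_neg]

theorem lapl_neg (n : ℕ) (u : EuclideanSpace ℝ (Fin n) → ℝ) (x : EuclideanSpace ℝ (Fin n)) :
    lapl n (fun y => -u y) x = -lapl n u x := by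
  simp [lapl, fderiv_fun_neg]

theorem EuclideanSpace.norm_le_card_mul {n : ℕ} (x : EuclideanSpace ℝ (Fin n)) {ρ : ℝ}
    (hx : ∀ j, |x j| ≤ ρ) : ‖x‖ ≤ n * ρ := by
  have h : x = ∑ j, x j • EuclideanSpace.single j (1 : ℝ) := by
    ext k
    simp [Finset.sum_apply, Pi.single_apply]
  calc ‖x‖ = ‖∑ j, x j • EuclideanSpace.single j (1 : ℝ)‖ := by rw [← h]
    _ ≤ ∑ j, ‖x j • EuclideanSpace.single j (1 : ℝ)‖ := norm_sum_le _ _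
    _ ≤ ∑ _j : Fin n, ρ := Finset.sum_le_sum fun j _ => by simpa [norm_smul] using hx j
    _ = n * ρ := by simp

/-- A functional on Euclidean space is controlled by its values on the standard basis. -/
theorem EuclideanSpace.opNorm_le_card_mul {n : ℕ} (L : EuclideanSpace ℝ (Fin n) →L[ℝ] ℝ) {b : ℝ}
    (hL : ∀ j, |L (EuclideanSpace.single j 1)| ≤ b) : ‖L‖ ≤ n * b := by
  rcases Nat.eq_zero_or_pos n with rfl | hn
  · have : L = 0 := by ext x; simp [Subsingleton.elim x 0]
    simp [this]
  have hb : 0 ≤ b := (abs_nonneg _).trans (hL ⟨0, hn⟩)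
  refine L.opNorm_le_bound (by positivity) fun x => ?_
  have h : x = ∑ j, x j • EuclideanSpace.single j (1 : ℝ) := by
    ext k
    simp [Finset.sum_apply, Pi.single_apply]
  calc ‖L x‖ = ‖∑ j, x j * L (EuclideanSpace.single j 1)‖ := by
        conv_lhs => rw [h]
        simp only [map_sum, map_smul, smul_eq_mul]
    _ ≤ ∑ j, ‖x j * L (EuclideanSpace.single j 1)‖ := norm_sum_le _ _
    _ ≤ ∑ _j : Fin n, ‖x‖ * b := Finset.sum_le_sum fun j _ => by
        rw [norm_mul]
        exact mul_le_mul (PiLp.norm_apply_le x j) (hL j) (norm_nonneg _) (norm_nonneg _)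
    _ = n * b * ‖x‖ := by simp; ring

/-- The closed cube with centre `c` and half-side `ρ`. -/
def closedCube {n : ℕ} (c : EuclideanSpace ℝ (Fin n)) (ρ : ℝ) : Set (EuclideanSpace ℝ (Fin n)) :=
  {x | ∀ j, |x j - c j| ≤ ρ}

theorem closedCube_subset_closedBall {n : ℕ} (c : EuclideanSpace ℝ (Fin n)) (ρ : ℝ) :
    closedCube c ρ ⊆ closedBall c (n * ρ) := fun x hx => by
  rw [mem_closedBall, dist_eq_norm]
  exact EuclideanSpace.norm_le_card_mul _ fun j => by simpa using hx j

theorem isCompact_closedCube {n : ℕ} (c : EuclideanSpace ℝ (Fin n)) (ρ : ℝ) :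
    IsCompact (closedCube c ρ) := by
  refine (isCompact_closedBall c (n * ρ)).of_isClosed_subset ?_ (closedCube_subset_closedBall c ρ)
  simp only [closedCube, ofPred_forall]
  exact isClosed_iInter fun j => isClosed_le (by fun_prop) continuous_const

/-- Reflection in the hyperplane through `c` orthogonal to the `i`-th coordinate direction. -/
noncomputable def coordReflect {n : ℕ} (i : Fin n) (c x : EuclideanSpace ℝ (Fin n)) :
    EuclideanSpace ℝ (Fin n) :=
  x - (2 * (x i - c i)) • EuclideanSpace.single i (1 : ℝ)

theorem coordReflect_apply_sub {n : ℕ} (i : Fin n) (c x : EuclideanSpace ℝ (Fin n)) (j : Fin n) :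
    coordReflect i c x j - c j = if j = i then -(x j - c j) else x j - c j := by
  by_cases h : j = i
  · subst h; simp [coordReflect]; ring
  · simp [coordReflect, h]

theorem coordReflect_mem_closedCube {n : ℕ} (i : Fin n) {c x : EuclideanSpace ℝ (Fin n)} {ρ : ℝ}
    (hx : x ∈ closedCube c ρ) : coordReflect i c x ∈ closedCube c ρ := fun j => by
  rw [coordReflect_apply_sub]
  split_ifs
  · rw [abs_neg]; exact hx j
  · exact hx j

theorem coordReflect_eq_self {n : ℕ} {i : Fin n} {c x : EuclideanSpace ℝ (Fin n)}
    (h : x i = c i) : coordReflect i c x = x := by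
  simp [coordReflect, h]

theorem coordReflect_add_smul_single {n : ℕ} (i j : Fin n) (c x : EuclideanSpace ℝ (Fin n))
    (t : ℝ) :
    coordReflect i c (x + t • EuclideanSpace.single j (1 : ℝ)) = coordReflect i c x +
      t • (if j = i then -EuclideanSpace.single j (1 : ℝ) else EuclideanSpace.single j (1 : ℝ)) := by
  by_cases h : j = i
  · subst h
    ext k
    by_cases hk : k = j
    · subst hk; simp [coordReflect]; ring
    · simp [coordReflect, hk]
  · have h' : i ≠ j := Ne.symm h
    ext k
    simp [coordReflect, h, h']
    ring

/-- Quadratic comparison function on a half-cube, with Laplacian `-N`. -/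
noncomputable def cubeBarrier {n : ℕ} (i : Fin n) (c : EuclideanSpace ℝ (Fin n)) (ρ M N : ℝ)
    (x : EuclideanSpace ℝ (Fin n)) : ℝ :=
  M / ρ ^ 2 * (∑ j, (x j - c j) ^ 2 + n * ((x i - c i) * (ρ - (x i - c i)))) +
    N / 2 * ((x i - c i) * (ρ - (x i - c i)))

theorem cubeBarrier_add_smul_single {n : ℕ} (i j : Fin n) (c x : EuclideanSpace ℝ (Fin n))
    (ρ M N : ℝ) : ∃ a : ℝ, ∀ t : ℝ,
    cubeBarrier i c ρ M N (x + t • EuclideanSpace.single j (1 : ℝ)) =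
      cubeBarrier i c ρ M N x + a * t +
        (M / ρ ^ 2 - if j = i then n * (M / ρ ^ 2) + N / 2 else 0) * t ^ 2 := by
  have hsum (t : ℝ) : ∑ k, ((x + t • EuclideanSpace.single j (1 : ℝ)) k - c k) ^ 2 =
      ∑ k, (x k - c k) ^ 2 + (2 * (x j - c j) * t + t ^ 2) := by
    rw [← Finset.sum_erase_add _ _ (Finset.mem_univ j),
      ← Finset.sum_erase_add _ (fun k => (x k - c k) ^ 2) (Finset.mem_univ j)]
    rw [Finset.sum_congr rfl (g := fun k => (x k - c k) ^ 2) fun k hk => by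
      simp [Finset.ne_of_mem_erase hk]]
    simp
    ring
  by_cases h : j = i
  · subst h
    refine ⟨M / ρ ^ 2 * (2 * (x j - c j) + n * (ρ - 2 * (x j - c j))) +
      N / 2 * (ρ - 2 * (x j - c j)), fun t => ?_⟩
    simp only [cubeBarrier, hsum, if_true]
    simp
    ring
  · refine ⟨M / ρ ^ 2 * (2 * (x j - c j)), fun t => ?_⟩
    have h' : i ≠ j := Ne.symm h
    simp only [cubeBarrier, hsum, if_neg h]
    simp [h']
    ring

open Filter Topology in
/-- Comparison of the odd part of `u` with the barrier on a half-cube. -/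
theorem half_sub_reflect_le_cubeBarrier {n : ℕ} {i : Fin n} {c : EuclideanSpace ℝ (Fin n)}
    {ρ M N : ℝ} (hρ : 0 < ρ) {Ω : Set (EuclideanSpace ℝ (Fin n))} (hΩ : IsOpen Ω)
    (hcube : closedCube c ρ ⊆ Ω) {u : EuclideanSpace ℝ (Fin n) → ℝ} (hu : ContDiffOn ℝ 2 u Ω)
    (hM : ∀ x ∈ closedCube c ρ, |u x| ≤ M) (hN : ∀ x ∈ closedCube c ρ, |lapl n u x| < N)
    {x : EuclideanSpace ℝ (Fin n)} (hx : x ∈ closedCube c ρ) (hxi : c i ≤ x i) :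
    (u x - u (coordReflect i c x)) / 2 ≤ cubeBarrier i c ρ M N x := by
  set w : EuclideanSpace ℝ (Fin n) → ℝ :=
    fun x => (u x - u (coordReflect i c x)) / 2 - cubeBarrier i c ρ M N x with hw
  set Q := closedCube c ρ ∩ {x | c i ≤ x i} with hQ
  have hQc : IsCompact Q :=
    (isCompact_closedCube c ρ).inter_right (isClosed_le continuous_const (by fun_prop))
  have hucont : ContinuousOn u (closedCube c ρ) := hu.continuousOn.mono hcube
  have hrefl : Continuous (coordReflect i c) := by unfold coordReflect; fun_prop
  have hbar : Continuous (cubeBarrier i c ρ M N) := by unfold cubeBarrier; fun_prop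
  have hwc : ContinuousOn w Q := by
    have h1 : ContinuousOn u Q := hucont.mono inter_subset_left
    have h2 : ContinuousOn (fun x => u (coordReflect i c x)) Q :=
      hucont.comp hrefl.continuousOn fun y hy => coordReflect_mem_closedCube i hy.1
    exact ((h1.sub h2).div_const 2).sub hbar.continuousOn
  obtain ⟨p, hpQ, hpmax⟩ := hQc.exists_isMaxOn ⟨x, hx, hxi⟩ hwc
  suffices hwp : w p ≤ 0 by
    have := hpmax (show x ∈ Q from ⟨hx, hxi⟩)
    simp only [mem_ofPred_eq] at this
    have h2 : w x ≤ 0 := this.trans hwp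
    simp only [hw] at h2
    linarith
  have hpR := coordReflect_mem_closedCube i hpQ.1
  have hM0 : 0 ≤ M := (abs_nonneg _).trans (hM p hpQ.1)
  have hN0 : 0 ≤ N := (abs_nonneg _).trans (hN p hpQ.1).le
  have hs0 : 0 ≤ p i - c i := sub_nonneg.2 hpQ.2
  have hsρ : 0 ≤ ρ - (p i - c i) := sub_nonneg.2 ((le_abs_self _).trans (hpQ.1 i))
  have hss := mul_nonneg hs0 hsρ
  by_cases hint : (∀ j, |p j - c j| < ρ) ∧ c i < p i
  · exfalso
    have hnhds : Q ∈ 𝓝 p := by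
      have hopen : IsOpen ({y : EuclideanSpace ℝ (Fin n) | ∀ j, |y j - c j| < ρ} ∩
          {y | c i < y i}) := by
        refine IsOpen.inter ?_ (isOpen_lt continuous_const (by fun_prop))
        simp only [ofPred_forall]
        exact isOpen_iInter_of_finite fun j => isOpen_lt (by fun_prop) continuous_const
      refine mem_of_superset (hopen.mem_nhds hint) fun y hy => ⟨fun j => (hy.1 j).le, ?_⟩
      exact (show c i < y i from hy.2).le
    have hlocal : IsLocalMax w p := hpmax.isLocalMax hnhds
    have hsecond (j : Fin n) :
        (fderiv ℝ (fun y => fderiv ℝ u y (EuclideanSpace.single j (1 : ℝ))) p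
            (EuclideanSpace.single j 1) -
          fderiv ℝ (fun y => fderiv ℝ u y (EuclideanSpace.single j (1 : ℝ))) (coordReflect i c p)
            (EuclideanSpace.single j 1)) / 2 -
          2 * (M / ρ ^ 2 - if j = i then n * (M / ρ ^ 2) + N / 2 else 0) ≤ 0 := by
      set e : EuclideanSpace ℝ (Fin n) := EuclideanSpace.single j (1 : ℝ) with he
      set v := if j = i then -e else e with hv
      set q := coordReflect i c p with hq
      set b := M / ρ ^ 2 - if j = i then n * (M / ρ ^ 2) + N / 2 else 0 with hb
      obtain ⟨a, ha⟩ := cubeBarrier_add_smul_single i j c p ρ M N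
      have hline (z y : EuclideanSpace ℝ (Fin n)) :
          Tendsto (fun t : ℝ => z + t • y) (𝓝 0) (𝓝 z) := by
        have : Continuous fun t : ℝ => z + t • y := by fun_prop
        simpa using this.tendsto 0
      have hdd : fderiv ℝ (fun y => fderiv ℝ u y v) q v =
          fderiv ℝ (fun y => fderiv ℝ u y e) q e := by
        rw [hv]; split_ifs
        · exact fderiv_fderiv_apply_neg u q e
        · rfl
      have hmax : IsLocalMax (fun t : ℝ => w (p + t • e)) 0 := by
        have := (hline p e).eventually hlocal
        simpa [IsLocalMax, IsMaxFilter] using this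
      have hw' (t : ℝ) : w (p + t • e) = (u (p + t • e) - u (q + t • v)) / 2 -
          (cubeBarrier i c ρ M N p + a * t + b * t ^ 2) := by
        simp only [hw, ha, he, coordReflect_add_smul_single]
        rfl
      have h1 : ∀ᶠ t in 𝓝 (0 : ℝ), HasDerivAt (fun t : ℝ => w (p + t • e))
          ((fderiv ℝ u (p + t • e) e - fderiv ℝ u (q + t • v) v) / 2 - (a + 2 * b * t)) t := by
        filter_upwards [(hline p e).eventually (hΩ.mem_nhds (hcube hpQ.1)),
          (hline q v).eventually (hΩ.mem_nhds (hcube hpR))] with t ht1 ht2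
        have hquad : HasDerivAt (fun t : ℝ => cubeBarrier i c ρ M N p + a * t + b * t ^ 2)
            (a + 2 * b * t) t := by
          refine HasDerivAt.congr_deriv
            ((((hasDerivAt_id' t).const_mul a).const_add (cubeBarrier i c ρ M N p)).add
              ((hasDerivAt_pow 2 t).const_mul b)) ?_
          simp
          ring
        refine HasDerivAt.congr_of_eventuallyEq ?_ (Eventually.of_forall hw')
        exact (((hu.hasDerivAt_comp_line hΩ ht1).sub
          (hu.hasDerivAt_comp_line hΩ ht2)).div_const 2).sub hquad
      have h2 : HasDerivAt (fun t : ℝ =>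
          (fderiv ℝ u (p + t • e) e - fderiv ℝ u (q + t • v) v) / 2 - (a + 2 * b * t))
          ((fderiv ℝ (fun y => fderiv ℝ u y e) p e -
            fderiv ℝ (fun y => fderiv ℝ u y e) q e) / 2 - 2 * b) 0 := by
        rw [← hdd]
        refine (((hu.hasDerivAt_fderiv_comp_line hΩ (hcube hpQ.1)).sub
          (hu.hasDerivAt_fderiv_comp_line hΩ (hcube hpR))).div_const 2).sub ?_
        simpa using ((hasDerivAt_id (0 : ℝ)).const_mul (2 * b)).const_add a
      exact hmax.second_deriv_nonpos h1 h2
    have hsum := Finset.sum_nonpos fun j (_ : j ∈ Finset.univ) => hsecond j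
    rw [Finset.sum_sub_distrib, ← Finset.sum_div, Finset.sum_sub_distrib, ← Finset.mul_sum,
      Finset.sum_sub_distrib] at hsum
    simp only [Finset.sum_ite_eq', Finset.mem_univ, if_true, Finset.sum_const, Finset.card_univ,
      Fintype.card_fin, nsmul_eq_mul] at hsum
    have e1 := abs_lt.1 (hN p hpQ.1)
    have e2 := abs_lt.1 (hN _ hpR)
    simp only [lapl] at e1 e2
    linarith [e1.1, e2.2]
  · rw [not_and_or] at hint
    have hn0 : (0 : ℝ) ≤ n := Nat.cast_nonneg n
    rcases hint with hside | hbot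
    · push Not at hside
      obtain ⟨j, hj⟩ := hside
      have hj2 : ρ ^ 2 ≤ ∑ k, (p k - c k) ^ 2 := calc
        ρ ^ 2 ≤ |p j - c j| ^ 2 := by gcongr
        _ = (p j - c j) ^ 2 := sq_abs _
        _ ≤ ∑ k, (p k - c k) ^ 2 :=
          Finset.single_le_sum (f := fun k => (p k - c k) ^ 2) (fun k _ => sq_nonneg _)
            (Finset.mem_univ j)
      have hbarM : M ≤ cubeBarrier i c ρ M N p := calc
        M = M / ρ ^ 2 * ρ ^ 2 := by field_simp
        _ ≤ M / ρ ^ 2 * (∑ k, (p k - c k) ^ 2 + n * ((p i - c i) * (ρ - (p i - c i)))) := by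
          gcongr
          linarith [mul_nonneg hn0 hss]
        _ ≤ cubeBarrier i c ρ M N p := by
          unfold cubeBarrier
          linarith [mul_nonneg (by positivity : 0 ≤ N / 2) hss]
      have e1 := abs_le.1 (hM p hpQ.1)
      have e2 := abs_le.1 (hM _ hpR)
      simp only [hw]
      linarith [e1.2, e2.1]
    · have hpi : p i = c i := le_antisymm (not_lt.1 hbot) hpQ.2
      have hb : 0 ≤ cubeBarrier i c ρ M N p := by
        unfold cubeBarrier
        have := Finset.sum_nonneg fun k (_ : k ∈ Finset.univ) => sq_nonneg (p k - c k)
        positivity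
      simp only [hw, coordReflect_eq_self hpi]
      linarith

theorem fderiv_single_le_of_lapl_lt {n : ℕ} (i : Fin n) {c : EuclideanSpace ℝ (Fin n)}
    {ρ M N : ℝ} (hρ : 0 < ρ) {Ω : Set (EuclideanSpace ℝ (Fin n))} (hΩ : IsOpen Ω)
    (hcube : closedCube c ρ ⊆ Ω) {u : EuclideanSpace ℝ (Fin n) → ℝ} (hu : ContDiffOn ℝ 2 u Ω)
    (hM : ∀ x ∈ closedCube c ρ, |u x| ≤ M) (hN : ∀ x ∈ closedCube c ρ, |lapl n u x| < N) :
    fderiv ℝ u c (EuclideanSpace.single i 1) ≤ n * M / ρ + N / 2 * ρ := by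
  set e : EuclideanSpace ℝ (Fin n) := EuclideanSpace.single i (1 : ℝ) with he
  have hc : c ∈ Ω := hcube fun j => by simpa using hρ.le
  have hbar (t : ℝ) : cubeBarrier i c ρ M N (c + t • e) =
      M / ρ ^ 2 * (t ^ 2 + n * (t * (ρ - t))) + N / 2 * (t * (ρ - t)) := by
    simp [cubeBarrier, he]
  have hline (t : ℝ) : coordReflect i c (c + t • e) = c + t • (-e) := by
    rw [he, coordReflect_add_smul_single, coordReflect_eq_self rfl, if_pos rfl]
  have hpoly : HasDerivAt
      (fun t : ℝ => M / ρ ^ 2 * (t ^ 2 + n * (t * (ρ - t))) + N / 2 * (t * (ρ - t)))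
      (n * M / ρ + N / 2 * ρ) 0 := by
    have h1 : HasDerivAt (fun t : ℝ => t * (ρ - t)) ρ 0 := by
      refine HasDerivAt.congr_deriv
        ((hasDerivAt_id' (0 : ℝ)).mul ((hasDerivAt_id' (0 : ℝ)).const_sub ρ)) ?_
      simp
    have h2 : HasDerivAt (fun t : ℝ => t ^ 2) 0 0 := by
      simpa using hasDerivAt_pow 2 (0 : ℝ)
    refine HasDerivAt.congr_deriv (((h2.add (h1.const_mul (n : ℝ))).const_mul (M / ρ ^ 2)).add
      (h1.const_mul (N / 2))) ?_
    field_simp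
    ring
  have h1 := hu.hasDerivAt_comp_line hΩ (q := c) (v := e) (t := 0) (by simpa using hc)
  have h2 := hu.hasDerivAt_comp_line hΩ (q := c) (v := -e) (t := 0) (by simpa using hc)
  have hd := ((h1.sub h2).div_const 2).sub hpoly
  have := hd.nonpos_of_nonpos_right hρ (by simp) fun t ht0 htρ => by
    have hmem : c + t • e ∈ closedCube c ρ := fun j => by
      by_cases hj : j = i
      · subst hj; simpa [he, abs_of_pos ht0] using htρ.le
      · simpa [he, hj] using hρ.le
    have := half_sub_reflect_le_cubeBarrier hρ hΩ hcube hu hM hN (i := i) hmem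
      (by simpa [he] using ht0.le)
    rw [hline, hbar] at this
    simpa using this
  simp only [zero_smul, add_zero, map_neg] at this
  linarith

/-- Interior gradient bound for the Laplacian on a cube. -/
theorem abs_fderiv_single_le_of_lapl_le {n : ℕ} (i : Fin n) {c : EuclideanSpace ℝ (Fin n)}
    {ρ M N : ℝ} (hρ : 0 < ρ) {Ω : Set (EuclideanSpace ℝ (Fin n))} (hΩ : IsOpen Ω)
    (hcube : closedCube c ρ ⊆ Ω) {u : EuclideanSpace ℝ (Fin n) → ℝ} (hu : ContDiffOn ℝ 2 u Ω)
    (hM : ∀ x ∈ closedCube c ρ, |u x| ≤ M) (hN : ∀ x ∈ closedCube c ρ, |lapl n u x| ≤ N) :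
    |fderiv ℝ u c (EuclideanSpace.single i 1)| ≤ n * M / ρ + N / 2 * ρ := by
  refine le_of_forall_pos_le_add fun ε hε => ?_
  have hN' : ∀ x ∈ closedCube c ρ, |lapl n u x| < N + 2 * ε / ρ := fun x hx =>
    (hN x hx).trans_lt (lt_add_of_pos_right _ (by positivity))
  have heq : n * M / ρ + N / 2 * ρ + ε = n * M / ρ + (N + 2 * ε / ρ) / 2 * ρ := by
    field_simp
    ring
  rw [heq]
  refine abs_le'.2 ⟨fderiv_single_le_of_lapl_lt i hρ hΩ hcube hu hM hN', ?_⟩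
  have := fderiv_single_le_of_lapl_lt i hρ hΩ hcube hu.neg (M := M) (N := N + 2 * ε / ρ)
    (fun x hx => by simpa using hM x hx)
    (fun x hx => by
      change |lapl n (fun y => -u y) x| < _
      rw [lapl_neg, abs_neg]
      exact hN' x hx)
  simpa [fderiv_neg] using this

/-- **Weighted interior gradient estimate for the Poisson equation**
(Proposition 2.1, inequality (2.14)). Let `Ω ⊂ ℝⁿ` be bounded and open and let
`u ∈ C²(Ω)`, `f ∈ C(Ω)` satisfy `Δu = f` on `Ω`. Then there is `C = C(n)` such that
for all `μ ∈ (0,1]`, `[u]^*_{1;Ω} ≤ C (μ⁻¹ sup_Ω |u| + μ |f|^{(2)}_{0;Ω})`.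
Here `d_x = dist(x, ∂Ω)` is realized as `infDist x Ωᶜ`, the conclusion
`[u]^*_{1;Ω} = sup_x d_x ‖∇u(x)‖ ≤ …` is stated pointwise, and the sup-type
quantities on the right are expressed through arbitrary upper bounds
`K₁ ≥ sup_Ω |u|` and `K₂ ≥ |f|^{(2)}_{0;Ω} = sup_x d_x² |f(x)|`. -/
theorem poisson_weighted_interior_gradient_estimate (n : ℕ) :
    ∃ C : ℝ, ∀ Ω : Set (EuclideanSpace ℝ (Fin n)),
      IsOpen Ω → Bornology.IsBounded Ω →
      ∀ u f : EuclideanSpace ℝ (Fin n) → ℝ,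
      ContDiffOn ℝ 2 u Ω →
      ContinuousOn f Ω →
      (∀ x ∈ Ω, lapl n u x = f x) →
      ∀ μ : ℝ, 0 < μ → μ ≤ 1 →
      ∀ K₁ K₂ : ℝ,
      (∀ x ∈ Ω, |u x| ≤ K₁) →
      (∀ x ∈ Ω, (infDist x Ωᶜ) ^ 2 * |f x| ≤ K₂) →
      ∀ x ∈ Ω, infDist x Ωᶜ * ‖fderiv ℝ u x‖ ≤ C * (μ⁻¹ * K₁ + μ * K₂) := by
  refine ⟨2 * n ^ 3 + 1, fun Ω hΩ _ u f hu _ hlap μ hμ hμ1 K₁ K₂ hK₁ hK₂ x hx => ?_⟩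
  have hK₁0 : 0 ≤ K₁ := (abs_nonneg _).trans (hK₁ x hx)
  have hK₂0 : 0 ≤ K₂ := le_trans (by positivity) (hK₂ x hx)
  set d := infDist x Ωᶜ with hd
  rcases infDist_nonneg.eq_or_lt' (a := d) with hd0 | hd0
  · rw [hd0, zero_mul]; positivity
  rcases Nat.eq_zero_or_pos n with rfl | hn
  · have : fderiv ℝ u x = 0 := by ext y; simp [Subsingleton.elim y 0]
    rw [this, norm_zero, mul_zero]
    positivity
  set ρ := μ * d / (2 * n) with hρ_def
  have hρ : 0 < ρ := by positivity
  have hdist : ∀ y ∈ closedCube x ρ, d / 2 ≤ infDist y Ωᶜ := fun y hy => by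
    have h1 := closedCube_subset_closedBall x ρ hy
    rw [mem_closedBall, dist_comm] at h1
    have h2 : n * ρ = μ * d / 2 := by rw [hρ_def]; field_simp
    have h3 : d ≤ infDist y Ωᶜ + dist x y := infDist_le_infDist_add_dist
    nlinarith
  have hcube : closedCube x ρ ⊆ Ω := fun y hy => by
    by_contra hy'
    have := hdist y hy
    rw [infDist_zero_of_mem (show y ∈ Ωᶜ from hy')] at this
    linarith
  have hlapN : ∀ y ∈ closedCube x ρ, |lapl n u y| ≤ 4 * K₂ / d ^ 2 := fun y hy => by
    rw [hlap y (hcube hy), le_div_iff₀ (by positivity)]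
    have h1 := hK₂ y (hcube hy)
    have h2 : (d / 2) ^ 2 ≤ infDist y Ωᶜ ^ 2 := by gcongr; exact hdist y hy
    nlinarith [mul_le_mul_of_nonneg_right h2 (abs_nonneg (f y))]
  have hgrad : ‖fderiv ℝ u x‖ ≤ n * (n * K₁ / ρ + 4 * K₂ / d ^ 2 / 2 * ρ) :=
    EuclideanSpace.opNorm_le_card_mul _ fun j =>
      abs_fderiv_single_le_of_lapl_le j hρ hΩ hcube hu (fun y hy => hK₁ y (hcube hy)) hlapN
  calc d * ‖fderiv ℝ u x‖ ≤ d * (n * (n * K₁ / ρ + 4 * K₂ / d ^ 2 / 2 * ρ)) := by gcongr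
    _ = 2 * n ^ 3 * (μ⁻¹ * K₁) + μ * K₂ := by
      rw [hρ_def]
      field_simp
      ring
    _ ≤ (2 * n ^ 3 + 1) * (μ⁻¹ * K₁ + μ * K₂) := by
      have h1 : 0 ≤ μ⁻¹ * K₁ := by positivity
      have h2 : 0 ≤ 2 * (n : ℝ) ^ 3 * (μ * K₂) := by positivity
      linarith
end
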